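/- arXiv:2001.08727 — 13 statements merged into one kernel-verified Lean document; each statement's English description precedes it below -/
import Mathlib

section
/- Fix an integer M ≥ 2, an integer w with 2 ≤ w ≤ M, and a real ρ with log₂(M/w) ≤ ρ ≤ log₂(M/(w−1)). Then the minimum of the download cost D(p), taken over all reduced query distributions p with MI leakage ρ^MI(p) ≤ ρ, equals w + (log₂(M/w) − ρ)/log₂(w/(w−1)). (This value is the inverse of the single-server weakly-private information retrieval capacity under the mutual-information leakage metric.) -/
open Finset Real

/-- A reduced query distribution on `M` files: for each file index `m`, a PMF on
binary vectors `u ∈ {0,1}^M` (encoded as subsets of `Fin M`), vanishing whenever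
`u_m = 0` (in particular, supported on nonzero vectors). -/
def IsRQD (M : ℕ) (p : Fin M → Finset (Fin M) → ℝ) : Prop :=
  (∀ m u, 0 ≤ p m u) ∧ (∀ m, ∑ u : Finset (Fin M), p m u = 1) ∧
    (∀ m u, m ∉ u → p m u = 0)

/-- Download cost `D(p) = (1/M) Σ_m Σ_u p(u|m) wt(u)`. -/
noncomputable def dlCost (M : ℕ) (p : Fin M → Finset (Fin M) → ℝ) : ℝ :=
  (1 / M) * ∑ m : Fin M, ∑ u : Finset (Fin M), p m u * u.card

/-- Mutual information leakage `ρ^MI(p)` with uniform file index. -/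
noncomputable def miLeak (M : ℕ) (p : Fin M → Finset (Fin M) → ℝ) : ℝ :=
  ∑ u : Finset (Fin M), ∑ m : Fin M,
    (1 / M) * p m u * Real.logb 2 (p m u / ((1 / M) * ∑ m' : Fin M, p m' u))

/-- Tangent-line bound for the logarithm along the integers at the chord `[w - 1, w]`. -/
lemma log_div_le_sub_mul_log (w k : ℕ) (hw : 2 ≤ w) (hk : 1 ≤ k) :
    Real.log ((k : ℝ) / w) ≤ ((k : ℝ) - w) * Real.log ((w : ℝ) / ((w : ℝ) - 1)) := by
  have hw' : (2 : ℝ) ≤ w := by exact_mod_cast hw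
  have hk' : (1 : ℝ) ≤ k := by exact_mod_cast hk
  have hw0 : (0 : ℝ) < (w : ℝ) - 1 := by linarith
  rcases le_total w k with h | h
  · obtain ⟨n, rfl⟩ := Nat.exists_eq_add_of_le h
    have key : ((w + n : ℕ) : ℝ) / w ≤ ((w : ℝ) / ((w : ℝ) - 1)) ^ n := by
      have hB := one_add_mul_le_pow (a := 1 / ((w : ℝ) - 1))
        (by have : 0 < 1 / ((w : ℝ) - 1) := by positivity
            linarith) n
      have e : 1 + 1 / ((w : ℝ) - 1) = (w : ℝ) / ((w : ℝ) - 1) := by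
        field_simp
        ring
      rw [e] at hB
      refine le_trans ?_ hB
      have h1 : 1 / (w : ℝ) ≤ 1 / ((w : ℝ) - 1) := one_div_le_one_div_of_le hw0 (by linarith)
      have h2 : ((w + n : ℕ) : ℝ) / w = 1 + n * (1 / (w : ℝ)) := by
        push_cast
        field_simp
      rw [h2]
      gcongr
    have := Real.log_le_log (by positivity) key
    rw [Real.log_pow] at this
    push_cast at this ⊢
    linarith
  · obtain ⟨n, rfl⟩ := Nat.exists_eq_add_of_le h
    set w' : ℝ := ((k + n : ℕ) : ℝ) with hw'def
    have hwpos : 0 < w' := by linarith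
    have key : (k : ℝ) / w' ≤ ((w' - 1) / w') ^ n := by
      have hB := one_add_mul_le_pow (a := -(1 / w'))
        (by have : 1 / w' ≤ 1 := by
              rw [div_le_one hwpos]
              linarith
            linarith) n
      have e : 1 + -(1 / w') = (w' - 1) / w' := by
        field_simp
        ring
      rw [e] at hB
      refine le_trans (le_of_eq ?_) hB
      have : (k : ℝ) = w' - n := by
        rw [hw'def]
        push_cast
        ring
      rw [this]
      field_simp
      ring
    have := Real.log_le_log (by positivity) key
    rw [Real.log_pow, ← inv_div w' (w' - 1), Real.log_inv (w' / (w' - 1))] at this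
    have e : (k : ℝ) - w' = -n := by
      rw [hw'def]
      push_cast
      ring
    rw [e]
    linarith

/-- Log-sum inequality for the contribution of a single query to the MI leakage. -/
lemma sum_mul_logb_card_le {M : ℕ} (hM : 0 < M) (u : Finset (Fin M)) (q : Fin M → ℝ)
    (h0 : ∀ m, 0 ≤ q m) (hu : ∀ m, m ∉ u → q m = 0) :
    ∑ m, (1 / M : ℝ) * q m * Real.logb 2 ((M : ℝ) / u.card) ≤
      ∑ m, (1 / M : ℝ) * q m * Real.logb 2 (q m / ((1 / M : ℝ) * ∑ m', q m')) := by
  have hM' : (0 : ℝ) < M := by exact_mod_cast hM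
  have hl2 : 0 < Real.log 2 := Real.log_pos (by norm_num)
  set S := ∑ m', q m' with hS
  have hSu : ∑ m ∈ u, q m = S := by
    rw [hS]
    exact Finset.sum_subset (Finset.subset_univ u) fun m _ hm => hu m hm
  rw [← Finset.sum_subset (Finset.subset_univ u) fun m _ hm => by rw [hu m hm]; ring,
    ← Finset.sum_subset (Finset.subset_univ u) fun m _ hm => by rw [hu m hm]; ring]
  rcases u.eq_empty_or_nonempty with rfl | hne
  · simp
  have hk : (0 : ℝ) < u.card := by exact_mod_cast hne.card_pos
  have point : ∀ m ∈ u, (1 / M : ℝ) * q m * Real.logb 2 ((M : ℝ) / u.card) +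
      (1 / M : ℝ) * (q m - S / u.card) / Real.log 2 ≤
      (1 / M : ℝ) * q m * Real.logb 2 (q m / ((1 / M : ℝ) * S)) := by
    intro m hm
    have hqS : q m ≤ S := Finset.single_le_sum (fun i _ => h0 i) (Finset.mem_univ m)
    have hS0 : 0 ≤ S := (h0 m).trans hqS
    rcases (h0 m).eq_or_lt with hq | hq
    · rw [← hq]
      have : 0 ≤ (1 / M : ℝ) * (S / u.card) / Real.log 2 := by positivity
      simp only [mul_zero, zero_mul, zero_sub, zero_add, mul_neg, neg_div]
      linarith
    · have hSpos : 0 < S := hq.trans_le hqS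
      have e : q m / ((1 / M : ℝ) * S) = (M : ℝ) / u.card * (q m * u.card / S) := by
        field_simp
      have hlog := Real.one_sub_inv_le_log_of_pos (x := q m * u.card / S) (by positivity)
      rw [e, Real.logb_mul (by positivity) (by positivity), mul_add]
      refine add_le_add le_rfl ?_
      have e2 : q m - S / u.card = q m * (1 - (q m * u.card / S)⁻¹) := by
        field_simp
      rw [e2, Real.logb, mul_div_assoc, mul_assoc, mul_div_assoc]
      gcongr
  have tot := Finset.sum_le_sum point
  rw [Finset.sum_add_distrib, ← Finset.sum_div, ← Finset.mul_sum u (fun m => q m - S / u.card),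
    Finset.sum_sub_distrib, hSu, Finset.sum_const, nsmul_eq_mul, mul_div_cancel₀ _ hk.ne'] at tot
  simpa using tot

lemma le_miLeak {M : ℕ} (hM : 0 < M) {p : Fin M → Finset (Fin M) → ℝ} (hp : IsRQD M p) :
    ∑ u : Finset (Fin M), ∑ m, (1 / M : ℝ) * p m u * Real.logb 2 ((M : ℝ) / u.card) ≤
      miLeak M p :=
  Finset.sum_le_sum fun u _ =>
    sum_mul_logb_card_le hM u (p · u) (fun m => hp.1 m u) fun m hm => hp.2.2 m u hm

lemma dlCost_eq {M : ℕ} (p : Fin M → Finset (Fin M) → ℝ) :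
    dlCost M p = ∑ u : Finset (Fin M), ∑ m, (1 / M : ℝ) * p m u * u.card := by
  rw [dlCost, Finset.sum_comm, Finset.mul_sum]
  simp only [Finset.mul_sum, mul_assoc]

/-- The joint distribution of file index and query has total mass one. -/
lemma IsRQD.sum_eq_one {M : ℕ} (hM : 0 < M) {p : Fin M → Finset (Fin M) → ℝ} (hp : IsRQD M p) :
    ∑ u : Finset (Fin M), ∑ m, (1 / M : ℝ) * p m u = 1 := by
  have hM' : (M : ℝ) ≠ 0 := by exact_mod_cast hM.ne'
  rw [Finset.sum_comm]
  simp only [← Finset.mul_sum, hp.2.1]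
  simp [hM']

/-- The converse: a linear trade-off between download cost and MI leakage. -/
lemma IsRQD.le_dlCost {M w : ℕ} (hM : 0 < M) (hw : 2 ≤ w) {p : Fin M → Finset (Fin M) → ℝ}
    (hp : IsRQD M p) :
    (w : ℝ) + (Real.logb 2 ((M : ℝ) / w) - miLeak M p) / Real.logb 2 ((w : ℝ) / ((w : ℝ) - 1)) ≤
      dlCost M p := by
  have hM' : (0 : ℝ) < M := by exact_mod_cast hM
  have hw' : (2 : ℝ) ≤ w := by exact_mod_cast hw
  have hl2 : 0 < Real.log 2 := Real.log_pos (by norm_num)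
  set L := Real.logb 2 ((w : ℝ) / ((w : ℝ) - 1)) with hL
  have hLpos : 0 < L := Real.logb_pos (by norm_num) (by
    rw [lt_div_iff₀ (by linarith)]
    linarith)
  have key : ∑ u : Finset (Fin M), ∑ m, (1 / M : ℝ) * p m u * (w * L + Real.logb 2 ((M : ℝ) / w)) ≤
      ∑ u : Finset (Fin M), ∑ m, ((1 / M : ℝ) * p m u * u.card * L +
        (1 / M : ℝ) * p m u * Real.logb 2 ((M : ℝ) / u.card)) := by
    refine Finset.sum_le_sum fun u _ => Finset.sum_le_sum fun m _ => ?_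
    by_cases hm : m ∈ u
    · have hk : 1 ≤ u.card := Finset.card_pos.2 ⟨m, hm⟩
      have hk' : (0 : ℝ) < u.card := by exact_mod_cast hk
      have h := div_le_div_of_nonneg_right (log_div_le_sub_mul_log w u.card hw hk) hl2.le
      rw [mul_div_assoc] at h
      change Real.logb 2 _ ≤ _ * L at h
      rw [Real.logb_div hk'.ne' (by positivity)] at h
      rw [Real.logb_div hM'.ne' hk'.ne', Real.logb_div hM'.ne' (by positivity), mul_assoc _ _ L,
        ← mul_add]
      have := hp.1 m u
      refine mul_le_mul_of_nonneg_left ?_ (by positivity)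
      linarith
    · simp [hp.2.2 m u hm]
  simp only [Finset.sum_add_distrib, ← Finset.sum_mul] at key
  rw [hp.sum_eq_one hM, one_mul] at key
  have hD : ∑ u : Finset (Fin M), (∑ m, (1 / M : ℝ) * p m u) * u.card = dlCost M p := by
    simp only [dlCost_eq, Finset.sum_mul]
  have hI : ∑ u : Finset (Fin M), (∑ m, (1 / M : ℝ) * p m u) * Real.logb 2 ((M : ℝ) / u.card) ≤
      miLeak M p := by
    simpa only [Finset.sum_mul] using le_miLeak hM hp
  rw [hD] at key
  rw [← le_sub_iff_add_le', div_le_iff₀ hLpos]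
  linarith

/-- The probability under `twoLevelDist` of each set of size `j` containing the requested index. -/
noncomputable def twoLevelWeight (M w : ℕ) (θ : ℝ) (j : ℕ) : ℝ :=
  (if j = w - 1 then θ / (M - 1).choose (w - 1 - 1) else 0) +
    if j = w then (1 - θ) / (M - 1).choose (w - 1) else 0

/-- Given `m`, the query is a uniformly random set containing `m` of size `w - 1` with
probability `θ` and of size `w` with probability `1 - θ`. -/
noncomputable def twoLevelDist (M w : ℕ) (θ : ℝ) (m : Fin M) (u : Finset (Fin M)) : ℝ :=
  if m ∈ u then twoLevelWeight M w θ u.card else 0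

lemma sum_ite_mem_card {M k : ℕ} (hk : 1 ≤ k) (m : Fin M) (x : ℝ) :
    ∑ u : Finset (Fin M), (if m ∈ u ∧ u.card = k then x else 0) =
      (M - 1).choose (k - 1) * x := by
  have h := card_filter_powersetCard_subset {m} (univ : Finset (Fin M)) k (by simp) (by simpa)
  simp only [card_singleton, card_univ, Fintype.card_fin, singleton_subset_iff] at h
  rw [← Finset.sum_filter, Finset.sum_const, nsmul_eq_mul, ← h]
  congr 3
  ext u
  simp [and_comm]

lemma sum_twoLevelDist_mul {M w : ℕ} (hw : 2 ≤ w) (hwM : w ≤ M) (θ : ℝ) (f : ℕ → ℝ)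
    (m : Fin M) :
    ∑ u : Finset (Fin M), twoLevelDist M w θ m u * f u.card = θ * f (w - 1) + (1 - θ) * f w := by
  have c1 : ((M - 1).choose (w - 1 - 1) : ℝ) ≠ 0 := by
    exact_mod_cast (Nat.choose_pos (by omega)).ne'
  have c2 : ((M - 1).choose (w - 1) : ℝ) ≠ 0 := by
    exact_mod_cast (Nat.choose_pos (by omega)).ne'
  have h : ∀ u : Finset (Fin M), twoLevelDist M w θ m u * f u.card =
      (if m ∈ u ∧ u.card = w - 1 then θ / (M - 1).choose (w - 1 - 1) * f (w - 1) else 0) +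
        if m ∈ u ∧ u.card = w then (1 - θ) / (M - 1).choose (w - 1) * f w else 0 := by
    intro u
    unfold twoLevelDist twoLevelWeight
    by_cases hm : m ∈ u
    · by_cases h1 : u.card = w - 1
      · have : w - 1 ≠ w := by omega
        simp [hm, h1, this]
      · by_cases h2 : u.card = w
        · have : w ≠ w - 1 := by omega
          simp [hm, h2, this]
        · simp [hm, h1, h2]
    · simp [hm]
  simp only [h, Finset.sum_add_distrib]
  rw [sum_ite_mem_card (by omega), sum_ite_mem_card (by omega)]
  field_simp

lemma isRQD_twoLevelDist {M w : ℕ} (hw : 2 ≤ w) (hwM : w ≤ M) {θ : ℝ} (h0 : 0 ≤ θ)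
    (h1 : θ ≤ 1) : IsRQD M (twoLevelDist M w θ) := by
  refine ⟨fun m u => ?_, fun m => ?_, fun m u hm => by simp [twoLevelDist, hm]⟩
  · have : 0 ≤ 1 - θ := by linarith
    unfold twoLevelDist twoLevelWeight
    positivity
  · simpa using sum_twoLevelDist_mul hw hwM θ (fun _ => 1) m

lemma average_twoLevelDist {M w : ℕ} (hw : 2 ≤ w) (hwM : w ≤ M) (θ : ℝ) (f : ℕ → ℝ) :
    ∑ u : Finset (Fin M), ∑ m, (1 / M : ℝ) * twoLevelDist M w θ m u * f u.card =
      θ * f (w - 1) + (1 - θ) * f w := by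
  have hM' : (M : ℝ) ≠ 0 := by
    have : M ≠ 0 := by omega
    exact_mod_cast this
  rw [Finset.sum_comm]
  simp only [mul_assoc, ← Finset.mul_sum, sum_twoLevelDist_mul hw hwM]
  simp only [sum_const, card_univ, Fintype.card_fin, nsmul_eq_mul]
  field_simp

lemma miLeak_twoLevelDist {M w : ℕ} (hw : 2 ≤ w) (hwM : w ≤ M) (θ : ℝ) :
    miLeak M (twoLevelDist M w θ) =
      θ * Real.logb 2 ((M : ℝ) / ((w - 1 : ℕ) : ℝ)) + (1 - θ) * Real.logb 2 ((M : ℝ) / w) := by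
  rw [← average_twoLevelDist hw hwM θ fun k => Real.logb 2 ((M : ℝ) / k)]
  refine Finset.sum_congr rfl fun u _ => Finset.sum_congr rfl fun m _ => ?_
  have hS : ∑ m', twoLevelDist M w θ m' u = u.card * twoLevelWeight M w θ u.card := by
    simp [twoLevelDist]
  rw [hS]
  by_cases hm : m ∈ u
  · have hk : (u.card : ℝ) ≠ 0 := by
      exact_mod_cast (Finset.card_pos.2 ⟨m, hm⟩).ne'
    simp only [twoLevelDist, hm, if_true]
    by_cases hc : twoLevelWeight M w θ u.card = 0
    · simp [hc]
    · congr 2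
      field_simp
  · simp [twoLevelDist, hm]

/-- The minimum download cost with MI leakage at most `ρ` equals
`w + (log₂(M/w) − ρ)/log₂(w/(w−1))` for `log₂(M/w) ≤ ρ ≤ log₂(M/(w−1))`. -/
theorem stmt0 (M w : ℕ) (hM : 2 ≤ M) (hw2 : 2 ≤ w) (hwM : w ≤ M) (ρ : ℝ)
    (hρ1 : Real.logb 2 ((M : ℝ) / w) ≤ ρ)
    (hρ2 : ρ ≤ Real.logb 2 ((M : ℝ) / ((w : ℝ) - 1))) :
    IsLeast {d : ℝ | ∃ p : Fin M → Finset (Fin M) → ℝ,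
        IsRQD M p ∧ miLeak M p ≤ ρ ∧ dlCost M p = d}
      ((w : ℝ) + (Real.logb 2 ((M : ℝ) / w) - ρ) / Real.logb 2 ((w : ℝ) / ((w : ℝ) - 1))) := by
  have hM' : (0 : ℝ) < M := by exact_mod_cast (by omega : 0 < M)
  have hw' : (2 : ℝ) ≤ w := by exact_mod_cast hw2
  have hw0 : (0 : ℝ) < (w : ℝ) - 1 := by linarith
  have hLpos : 0 < Real.logb 2 ((w : ℝ) / ((w : ℝ) - 1)) := Real.logb_pos (by norm_num) (by
    rw [lt_div_iff₀ hw0]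
    linarith)
  have hcast : ((w - 1 : ℕ) : ℝ) = (w : ℝ) - 1 := by
    rw [Nat.cast_sub (by omega), Nat.cast_one]
  have hdiff : Real.logb 2 ((M : ℝ) / ((w : ℝ) - 1)) =
      Real.logb 2 ((M : ℝ) / w) + Real.logb 2 ((w : ℝ) / ((w : ℝ) - 1)) := by
    rw [← Real.logb_mul (by positivity) (by positivity)]
    congr 1
    field_simp
  constructor
  · set L := Real.logb 2 ((w : ℝ) / ((w : ℝ) - 1)) with hL
    set θ := (ρ - Real.logb 2 ((M : ℝ) / w)) / L with hθ
    have hθL : θ * L = ρ - Real.logb 2 ((M : ℝ) / w) := div_mul_cancel₀ _ hLpos.ne'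
    refine ⟨twoLevelDist M w θ, isRQD_twoLevelDist hw2 hwM
      (div_nonneg (by linarith) hLpos.le) ((div_le_one hLpos).2 (by linarith)), ?_, ?_⟩
    · rw [miLeak_twoLevelDist hw2 hwM, hcast, hdiff]
      linarith
    · rw [dlCost_eq, average_twoLevelDist hw2 hwM θ fun k => (k : ℝ), hcast, ← neg_sub ρ, neg_div,
        ← hθ]
      ring
  · rintro d ⟨p, hp, hle, rfl⟩
    refine le_trans ?_ (hp.le_dlCost (by omega) hw2)
    gcongr
end

section
/- Fix an integer M ≥ 2, an integer w with 2 ≤ w ≤ M, and a real t with M/w ≤ t ≤ M/(w−1). Then the minimum of the download cost D(p), taken over all reduced query distributions p with MaxL quantity Λ(p) ≤ t, equals w + (M/w − t)/(M/(w−1) − M/w). (Writing t = 2^ρ, this value is the inverse of the single-server weakly-private information retrieval capacity under the maximal-leakage metric at leakage level ρ.) -/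
open Finset Real

/-- MaxL quantity `Λ(p) = Σ_u max_m p(u|m)`. -/
noncomputable def maxlQ (M : ℕ) (p : Fin M → Finset (Fin M) → ℝ) : ℝ :=
  ∑ u : Finset (Fin M), ⨆ m : Fin M, p m u

/-- The scheme querying, given the index `m`, a uniformly random set of `k` files containing `m`. -/
noncomputable def uniformScheme (M k : ℕ) (m : Fin M) (u : Finset (Fin M)) : ℝ :=
  if m ∈ u ∧ u.card = k then ((M - 1).choose (k - 1) : ℝ)⁻¹ else 0

lemma card_filter_mem_and_card_eq {α : Type*} [Fintype α] [DecidableEq α] (a : α) {k : ℕ}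
    (hk : 1 ≤ k) :
    (univ.filter fun u : Finset α => a ∈ u ∧ u.card = k).card =
      (Fintype.card α - 1).choose (k - 1) := by
  have himage : (univ.filter fun u : Finset α => a ∈ u ∧ u.card = k) =
      (powersetCard (k - 1) (univ.erase a)).image (insert a) := by
    ext u
    simp only [mem_filter, mem_univ, true_and, mem_image, mem_powersetCard]
    constructor
    · rintro ⟨ha, rfl⟩
      exact ⟨u.erase a, ⟨erase_subset_erase _ (subset_univ _), card_erase_of_mem ha⟩,
        insert_erase ha⟩
    · rintro ⟨v, ⟨hv, hcard⟩, rfl⟩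
      have ha : a ∉ v := fun h => notMem_erase a univ (hv h)
      exact ⟨mem_insert_self _ _, by rw [card_insert_of_notMem ha]; omega⟩
  rw [himage, card_image_of_injOn, card_powersetCard, card_erase_of_mem (mem_univ a), card_univ]
  intro v hv v' hv' h
  have hnot : ∀ x ∈ powersetCard (k - 1) (univ.erase a), a ∉ x := fun x hx hax =>
    notMem_erase a univ ((mem_powersetCard.1 hx).1 hax)
  rw [← erase_insert (hnot v hv), ← erase_insert (hnot v' hv')]
  exact congrArg (fun x => x.erase a) h

lemma choose_pred_pos {M k : ℕ} (hk : 1 ≤ k) (hkM : k ≤ M) :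
    (0 : ℝ) < (M - 1).choose (k - 1) := by
  exact_mod_cast Nat.choose_pos (by omega)

lemma uniformScheme_isRQD {M k : ℕ} (hk : 1 ≤ k) (hkM : k ≤ M) :
    IsRQD M (uniformScheme M k) := by
  refine ⟨fun m u => ?_, fun m => ?_, fun m u hm => ?_⟩
  · unfold uniformScheme
    split_ifs <;> positivity
  · unfold uniformScheme
    rw [← sum_filter, sum_const, card_filter_mem_and_card_eq m hk, Fintype.card_fin, nsmul_eq_mul,
      mul_inv_cancel₀ (choose_pred_pos hk hkM).ne']
  · simp [uniformScheme, hm]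

lemma dlCost_uniformScheme {M k : ℕ} (hk : 1 ≤ k) (hkM : k ≤ M) :
    dlCost M (uniformScheme M k) = k := by
  have hM : (M : ℝ) ≠ 0 := by
    have : M ≠ 0 := by omega
    exact_mod_cast this
  have hmul : ∀ m u, uniformScheme M k m u * (u.card : ℝ) = uniformScheme M k m u * k := by
    intro m u
    unfold uniformScheme
    split_ifs with h
    · rw [h.2]
    · simp
  simp only [dlCost, hmul, ← sum_mul, (uniformScheme_isRQD hk hkM).2.1]
  simp
  field_simp

lemma maxlQ_uniformScheme_le {M k : ℕ} (hk : 1 ≤ k) (hkM : k ≤ M) :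
    maxlQ M (uniformScheme M k) ≤ M / k := by
  have : Nonempty (Fin M) := ⟨⟨0, by omega⟩⟩
  have hC := choose_pred_pos hk hkM
  calc maxlQ M (uniformScheme M k)
      ≤ ∑ u : Finset (Fin M), if u.card = k then ((M - 1).choose (k - 1) : ℝ)⁻¹ else 0 := by
        refine sum_le_sum fun u _ => ciSup_le fun m => ?_
        unfold uniformScheme
        split_ifs <;> first | exact le_rfl | positivity | simp_all
    _ = M.choose k * ((M - 1).choose (k - 1) : ℝ)⁻¹ := by
        rw [← sum_filter, sum_const, nsmul_eq_mul, ← powerset_univ, ← powersetCard_eq_filter,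
          card_powersetCard, card_fin]
    _ = M / k := by
        have h : (M : ℝ) * (M - 1).choose (k - 1) = M.choose k * k := by
          obtain ⟨n, rfl⟩ : ∃ n, M = n + 1 := ⟨M - 1, by omega⟩
          obtain ⟨j, rfl⟩ : ∃ j, k = j + 1 := ⟨k - 1, by omega⟩
          exact_mod_cast Nat.add_one_mul_choose_eq n j
        have hk' : (k : ℝ) ≠ 0 := by
          have : k ≠ 0 := by omega
          exact_mod_cast this
        field_simp
        linarith

lemma IsRQD.convex {M : ℕ} {p q : Fin M → Finset (Fin M) → ℝ} (hp : IsRQD M p) (hq : IsRQD M q)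
    {a b : ℝ} (ha : 0 ≤ a) (hb : 0 ≤ b) (hab : a + b = 1) :
    IsRQD M fun m u => a * p m u + b * q m u := by
  refine ⟨fun m u => ?_, fun m => ?_, fun m u hm => ?_⟩
  · exact add_nonneg (mul_nonneg ha (hp.1 m u)) (mul_nonneg hb (hq.1 m u))
  · rw [sum_add_distrib, ← mul_sum, ← mul_sum, hp.2.1, hq.2.1, mul_one, mul_one, hab]
  · simp [hp.2.2 m u hm, hq.2.2 m u hm]

lemma dlCost_combination {M : ℕ} (p q : Fin M → Finset (Fin M) → ℝ) (a b : ℝ) :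
    dlCost M (fun m u => a * p m u + b * q m u) = a * dlCost M p + b * dlCost M q := by
  simp only [dlCost, add_mul, sum_add_distrib, mul_assoc, ← mul_sum]
  ring

lemma maxlQ_combination_le {M : ℕ} [NeZero M] (p q : Fin M → Finset (Fin M) → ℝ) {a b : ℝ}
    (ha : 0 ≤ a) (hb : 0 ≤ b) :
    maxlQ M (fun m u => a * p m u + b * q m u) ≤ a * maxlQ M p + b * maxlQ M q := by
  simp only [maxlQ, mul_sum, ← sum_add_distrib]
  refine sum_le_sum fun u _ => ciSup_le fun m => ?_
  exact add_le_add
    (mul_le_mul_of_nonneg_left (le_ciSup (f := fun m => p m u) (Set.finite_range _).bddAbove m) ha)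
    (mul_le_mul_of_nonneg_left (le_ciSup (f := fun m => q m u) (Set.finite_range _).bddAbove m) hb)

lemma sum_le_card_mul_iSup {M : ℕ} {p : Fin M → Finset (Fin M) → ℝ} (hp : IsRQD M p)
    (u : Finset (Fin M)) : ∑ m, p m u ≤ u.card * ⨆ m, p m u := by
  rw [← sum_subset (subset_univ u) fun m _ hm => hp.2.2 m u hm, ← nsmul_eq_mul]
  exact sum_le_card_nsmul _ _ _ fun m _ =>
    le_ciSup (f := fun m => p m u) (Set.finite_range _).bddAbove m

/-- The supporting line of the trade-off region through the points `(M / w, w)` and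
`(M / (w - 1), w - 1)`. -/
lemma IsRQD.le_dlCost_add_maxlQ {M w : ℕ} (hM : 1 ≤ M) (hw : 1 ≤ w)
    {p : Fin M → Finset (Fin M) → ℝ} (hp : IsRQD M p) :
    (2 * w - 1) * (M : ℝ) ≤ M * dlCost M p + w * (w - 1) * maxlQ M p := by
  have hM0 : (M : ℝ) ≠ 0 := by
    have : M ≠ 0 := by omega
    exact_mod_cast this
  have hw' : (1 : ℝ) ≤ w := by exact_mod_cast hw
  have htotal : ∑ u : Finset (Fin M), ∑ m, p m u = M := by
    rw [sum_comm]
    simp [hp.2.1]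
  have hcost : M * dlCost M p = ∑ u : Finset (Fin M), (∑ m, p m u) * u.card := by
    rw [dlCost, ← mul_assoc, mul_one_div_cancel hM0, one_mul, sum_comm]
    simp only [sum_mul]
  rw [hcost, maxlQ, mul_sum, ← sum_add_distrib]
  nth_rewrite 1 [← htotal]
  rw [mul_sum]
  refine sum_le_sum fun u _ => ?_
  have hsum := sum_le_card_mul_iSup hp u
  have hsum0 : 0 ≤ ∑ m, p m u := sum_nonneg fun m _ => hp.1 m u
  have hsup0 : 0 ≤ ⨆ m, p m u := Real.iSup_nonneg fun m => hp.1 m u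
  have hww : (0 : ℝ) ≤ w * (w - 1) := by nlinarith
  generalize ∑ m, p m u = s at *
  generalize (⨆ m, p m u) = x at *
  rcases Nat.eq_zero_or_pos u.card with hu | hu
  · rw [hu] at hsum ⊢
    have : s = 0 := by simp at hsum; linarith
    rw [this]
    simp
    positivity
  · have hk : (0 : ℝ) < u.card := by exact_mod_cast hu
    have hgap : (0 : ℝ) ≤ ((u.card : ℝ) - w) * (u.card - w + 1) := by
      have : (0 : ℤ) ≤ ((u.card : ℤ) - w) * (u.card - w + 1) := by
        rcases lt_or_ge (u.card : ℤ) w with h | h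
        · exact mul_nonneg_of_nonpos_of_nonpos (by omega) (by omega)
        · exact mul_nonneg (by omega) (by omega)
      exact_mod_cast this
    refine le_of_mul_le_mul_left ?_ hk
    nlinarith [mul_nonneg hsum0 hgap, mul_le_mul_of_nonneg_left hsum hww]

/-- The minimum download cost with MaxL quantity at most `t` equals
`w + (M/w − t)/(M/(w−1) − M/w)` for `M/w ≤ t ≤ M/(w−1)`. -/
theorem stmt1 (M w : ℕ) (hM : 2 ≤ M) (hw2 : 2 ≤ w) (hwM : w ≤ M) (t : ℝ)
    (ht1 : (M : ℝ) / w ≤ t) (ht2 : t ≤ (M : ℝ) / ((w : ℝ) - 1)) :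
    IsLeast {d : ℝ | ∃ p : Fin M → Finset (Fin M) → ℝ,
        IsRQD M p ∧ maxlQ M p ≤ t ∧ dlCost M p = d}
      ((w : ℝ) + ((M : ℝ) / w - t) / ((M : ℝ) / ((w : ℝ) - 1) - (M : ℝ) / w)) := by
  have hM0 : (0 : ℝ) < M := by
    have : 0 < M := by omega
    exact_mod_cast this
  have hw' : (2 : ℝ) ≤ w := by exact_mod_cast hw2
  have hw0 : (0 : ℝ) < w := by linarith
  have hw1 : (0 : ℝ) < (w : ℝ) - 1 := by linarith
  have : NeZero M := ⟨by omega⟩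
  have hgap : (M : ℝ) / (w - 1) - M / w = M / (w * (w - 1)) := by
    field_simp
    ring
  have hgap0 : (0 : ℝ) < (M : ℝ) / (w - 1) - M / w := by
    rw [hgap]
    positivity
  constructor
  · set c := (t - (M : ℝ) / w) / ((M : ℝ) / (w - 1) - M / w) with hc
    have hc0 : 0 ≤ c := div_nonneg (by linarith) hgap0.le
    have hc1 : c ≤ 1 := (div_le_one hgap0).2 (by linarith)
    have hct : c * ((M : ℝ) / (w - 1) - M / w) = t - M / w := div_mul_cancel₀ _ hgap0.ne'
    have hcast : ((w - 1 : ℕ) : ℝ) = w - 1 := by push_cast [show 1 ≤ w by omega]; ring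
    have hΛ := maxlQ_uniformScheme_le (M := M) (k := w) (by omega) hwM
    have hΛ' := maxlQ_uniformScheme_le (M := M) (k := w - 1) (by omega) (by omega)
    rw [hcast] at hΛ'
    refine ⟨fun m u => (1 - c) * uniformScheme M w m u + c * uniformScheme M (w - 1) m u,
      (uniformScheme_isRQD (by omega) hwM).convex (uniformScheme_isRQD (by omega) (by omega))
        (by linarith) hc0 (by ring), ?_, ?_⟩
    · refine (maxlQ_combination_le _ _ (by linarith) hc0).trans ?_
      linarith [mul_le_mul_of_nonneg_left hΛ (by linarith : 0 ≤ 1 - c),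
        mul_le_mul_of_nonneg_left hΛ' hc0]
    · rw [dlCost_combination, dlCost_uniformScheme (by omega) hwM,
        dlCost_uniformScheme (by omega) (by omega), hcast,
        show (M : ℝ) / w - t = -(t - M / w) by ring, neg_div, ← hc]
      ring
  · rintro d ⟨p, hp, hΛ, rfl⟩
    have hline := hp.le_dlCost_add_maxlQ (w := w) (by omega) (by omega)
    have hΛ' := mul_le_mul_of_nonneg_left hΛ (mul_pos hw0 hw1).le
    refine le_of_mul_le_mul_left ?_ hM0
    have hval : (M : ℝ) * (w + (M / w - t) / (M / (w - 1) - M / w)) =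
        (2 * w - 1) * M - w * (w - 1) * t := by
      rw [hgap]
      field_simp
      ring
    linarith
end

section
/- For every reduced query distribution p on M ≥ 2 files, the download cost is bounded below in terms of the MI leakage by D(p) ≥ M · 2^{−ρ^MI(p)}. Equivalently, the single-server WPIR capacity under the MI leakage metric with normalized leakage ρ̄ = ρ/log₂ M is at most 1/M^{1−ρ̄}. -/
open Finset Real

/-- Weighted AM–GM applied to the likelihood ratios `q u / p m u` under the joint law of
the file index and the query, where `q` is the marginal law of the query. -/
theorem two_rpow_neg_miLeak_le (M : ℕ) (hM : M ≠ 0) (p : Fin M → Finset (Fin M) → ℝ)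
    (hp : IsRQD M p) :
    (2 : ℝ) ^ (-(miLeak M p)) ≤ ∑ u : Finset (Fin M), ∑ m : Fin M,
      (1 / M) * p m u * (((1 / M) * ∑ m' : Fin M, p m' u) / p m u) := by
  obtain ⟨h0, h1, -⟩ := hp
  have hM' : (0 : ℝ) < M := by exact_mod_cast Nat.pos_of_ne_zero hM
  have hq : ∀ u, 0 ≤ (1 / M : ℝ) * ∑ m' : Fin M, p m' u := fun u =>
    mul_nonneg (by positivity) (sum_nonneg fun m _ => h0 m u)
  have amgm := Real.geom_mean_le_arith_mean_weighted
    (univ : Finset (Finset (Fin M) × Fin M)) (fun x => (1 / M) * p x.2 x.1)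
    (fun x => ((1 / M) * ∑ m' : Fin M, p m' x.1) / p x.2 x.1)
    (fun x _ => mul_nonneg (by positivity) (h0 _ _))
    (by
      rw [Fintype.sum_prod_type, sum_comm]
      simp_rw [← mul_sum, h1]
      simp [hM'.ne'])
    (fun x _ => div_nonneg (hq _) (h0 _ _))
  rw [Fintype.sum_prod_type] at amgm
  refine le_of_eq_of_le ?_ amgm
  rw [miLeak, ← Fintype.sum_prod_type', ← sum_neg_distrib,
    Real.rpow_sum_of_pos two_pos]
  refine prod_congr rfl fun x _ => ?_
  rcases (h0 x.2 x.1).eq_or_lt with hx | hx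
  · simp [← hx]
  · have hsum : 0 < ∑ m' : Fin M, p m' x.1 :=
      hx.trans_le (single_le_sum (f := fun m' => p m' x.1) (fun m _ => h0 m _) (mem_univ x.2))
    rw [← mul_neg, ← Real.logb_inv, inv_div, mul_comm (_ * p x.2 x.1),
      Real.rpow_mul two_pos.le, Real.rpow_logb two_pos (by norm_num) (by positivity)]

/-- For every reduced query distribution, `D(p) ≥ M · 2^(−ρ^MI(p))`; i.e., the
single-server WPIR capacity under MI leakage is at most `1/M^(1−ρ̄)`. -/
theorem stmt2 (M : ℕ) (hM : 2 ≤ M) (p : Fin M → Finset (Fin M) → ℝ)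
    (hp : IsRQD M p) :
    (M : ℝ) * (2 : ℝ) ^ (-(miLeak M p)) ≤ dlCost M p := by
  obtain ⟨h0, -, hu⟩ := id hp
  have hM' : (0 : ℝ) < M := by exact_mod_cast (by omega : 0 < M)
  have hq : ∀ u, 0 ≤ (1 / M : ℝ) * ∑ m' : Fin M, p m' u := fun u =>
    mul_nonneg (by positivity) (sum_nonneg fun m _ => h0 m u)
  refine (mul_le_mul_of_nonneg_left (two_rpow_neg_miLeak_le M (by omega) p hp) hM'.le).trans ?_
  rw [dlCost, sum_comm (s := (univ : Finset (Fin M))), mul_sum, mul_sum]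
  refine sum_le_sum fun u _ => ?_
  calc (M : ℝ) * ∑ m : Fin M, (1 / M) * p m u * (((1 / M) * ∑ m' : Fin M, p m' u) / p m u)
      ≤ ∑ m : Fin M, if m ∈ u then (1 / M) * ∑ m' : Fin M, p m' u else 0 := by
        rw [mul_sum]
        refine sum_le_sum fun m _ => ?_
        split_ifs with hm
        · rcases (h0 m u).eq_or_lt with hx | hx
          · simpa [← hx] using hq u
          · apply le_of_eq
            field_simp
        · simp [hu m u hm]
    _ = (1 / M) * ∑ m : Fin M, p m u * u.card := by
        rw [← sum_filter, filter_mem_eq_inter, univ_inter, sum_const, nsmul_eq_mul, ← sum_mul]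
        ring
end

section
/- Let X, Y, Z be finite nonempty sets, let W(y|x) be a conditional probability distribution from X to Y (each W(·|x) is a probability mass function on Y), and let V(z|y) be a conditional probability distribution from Y to Z. Define the composed conditional distribution (V∘W)(z|x) = Σ_y W(y|x)·V(z|y). Then Σ_z max_{x∈X} (V∘W)(z|x) ≤ min( Σ_y max_{x∈X} W(y|x), Σ_z max_{y∈Y} V(z|y) ). In particular, the maximal leakage satisfies the data processing inequality MaxL(X→Z) ≤ min(MaxL(X→Y), MaxL(Y→Z)) along a Markov chain X → Y → Z. -/
open Finset Real

/-- Data processing inequality for (2 raised to) the maximal leakage along a Markov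
chain `X → Y → Z` given by channels `W` and `V`:
`Σ_z max_x (V∘W)(z|x) ≤ min(Σ_y max_x W(y|x), Σ_z max_y V(z|y))`. -/
theorem stmt5 (X Y Z : Type*) [Fintype X] [Fintype Y] [Fintype Z]
    [Nonempty X] [Nonempty Y] [Nonempty Z]
    (W : X → Y → ℝ) (V : Y → Z → ℝ)
    (hW0 : ∀ x y, 0 ≤ W x y) (hW1 : ∀ x, ∑ y : Y, W x y = 1)
    (hV0 : ∀ y z, 0 ≤ V y z) (hV1 : ∀ y, ∑ z : Z, V y z = 1) :
    ∑ z : Z, ⨆ x : X, (∑ y : Y, W x y * V y z)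
      ≤ min (∑ y : Y, ⨆ x : X, W x y) (∑ z : Z, ⨆ y : Y, V y z) := by
  refine le_min ?_ (sum_le_sum fun z _ => ciSup_le fun x => ?_)
  · calc ∑ z : Z, ⨆ x : X, (∑ y : Y, W x y * V y z)
        ≤ ∑ z : Z, ∑ y : Y, (⨆ x : X, W x y) * V y z :=
          sum_le_sum fun z _ => ciSup_le fun x => sum_le_sum fun y _ =>
            mul_le_mul_of_nonneg_right
              (le_ciSup (f := fun x => W x y) (Set.finite_range _).bddAbove x) (hV0 y z)
      _ = ∑ y : Y, ⨆ x : X, W x y := by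
          rw [sum_comm]
          simp_rw [← mul_sum, hV1, mul_one]
  · calc ∑ y : Y, W x y * V y z
        ≤ ∑ y : Y, W x y * ⨆ y : Y, V y z :=
          sum_le_sum fun y _ => mul_le_mul_of_nonneg_left
            (le_ciSup (f := fun y => V y z) (Set.finite_range _).bddAbove y) (hW0 x y)
      _ = ⨆ y : Y, V y z := by rw [← sum_mul, hW1, one_mul]
end

section
/- Fix an integer M ≥ 2 and define, for ρ ∈ [0, log₂ M], the MI download-leakage function D^MI(ρ) as the infimum of the download cost D(p) over all reduced query distributions p with MI leakage ρ^MI(p) ≤ ρ. Then D^MI is convex: for all ρ₁, ρ₂ ∈ [0, log₂ M] and λ ∈ [0,1], D^MI((1−λ)ρ₁ + λρ₂) ≤ (1−λ)D^MI(ρ₁) + λD^MI(ρ₂). -/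
open Finset Real

/-- The MI download-leakage function: infimum of the download cost over reduced
query distributions with MI leakage at most `ρ`. -/
noncomputable def DMI (M : ℕ) (ρ : ℝ) : ℝ :=
  sInf {d : ℝ | ∃ p : Fin M → Finset (Fin M) → ℝ,
    IsRQD M p ∧ miLeak M p ≤ ρ ∧ dlCost M p = d}

lemma mul_log_add_sub_le_mul_log_div {a b c : ℝ} (ha : 0 ≤ a) (hb : 0 ≤ b)
    (hab : b = 0 → a = 0) (hc : 0 < c) :
    a * Real.log c + a - b * c ≤ a * Real.log (a / b) := by
  rcases ha.eq_or_lt with rfl | ha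
  · simpa using mul_nonneg hb hc.le
  have hb' : 0 < b := hb.lt_of_ne fun h => ha.ne' (hab h.symm)
  have h := Real.log_le_sub_one_of_pos (show 0 < b * c / a by positivity)
  rw [Real.log_div (by positivity) ha.ne', Real.log_mul hb'.ne' hc.ne'] at h
  rw [Real.log_div ha.ne' hb'.ne']
  have h2 := mul_le_mul_of_nonneg_left h ha.le
  have h3 : a * (b * c / a - 1) = b * c - a := by field_simp
  linarith

/-- Joint convexity of the perspective function `(a, b) ↦ a * log (a / b)`. -/
lemma mul_log_div_convex_comb_le {a₁ a₂ b₁ b₂ t : ℝ} (ha₁ : 0 ≤ a₁) (ha₂ : 0 ≤ a₂)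
    (hb₁ : 0 ≤ b₁) (hb₂ : 0 ≤ b₂) (h₁ : b₁ = 0 → a₁ = 0) (h₂ : b₂ = 0 → a₂ = 0)
    (ht0 : 0 ≤ t) (ht1 : t ≤ 1) :
    ((1 - t) * a₁ + t * a₂) *
        Real.log (((1 - t) * a₁ + t * a₂) / ((1 - t) * b₁ + t * b₂)) ≤
      (1 - t) * (a₁ * Real.log (a₁ / b₁)) + t * (a₂ * Real.log (a₂ / b₂)) := by
  have hs : 0 ≤ 1 - t := by linarith
  have hA₁ := mul_nonneg hs ha₁
  have hA₂ := mul_nonneg ht0 ha₂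
  have hB₁ := mul_nonneg hs hb₁
  have hB₂ := mul_nonneg ht0 hb₂
  by_cases hA : (1 - t) * a₁ + t * a₂ = 0
  · have e₁ : (1 - t) * a₁ = 0 := by linarith
    have e₂ : t * a₂ = 0 := by linarith
    rw [← mul_assoc, ← mul_assoc, e₁, e₂]
    simp
  have hB : (1 - t) * b₁ + t * b₂ ≠ 0 := by
    intro hB
    have e₁ : (1 - t) * b₁ = 0 := by linarith
    have e₂ : t * b₂ = 0 := by linarith
    apply hA
    rcases mul_eq_zero.1 e₁ with e₁ | e₁ <;> rcases mul_eq_zero.1 e₂ with e₂ | e₂ <;>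
      first | linarith | simp [e₁, e₂, h₁, h₂]
  have hApos : 0 < (1 - t) * a₁ + t * a₂ := (add_nonneg hA₁ hA₂).lt_of_ne' hA
  have hBpos : 0 < (1 - t) * b₁ + t * b₂ := (add_nonneg hB₁ hB₂).lt_of_ne' hB
  have hc := div_pos hApos hBpos
  have hBc := div_mul_cancel₀ ((1 - t) * a₁ + t * a₂) hB
  set c := ((1 - t) * a₁ + t * a₂) / ((1 - t) * b₁ + t * b₂)
  have k₁ := mul_le_mul_of_nonneg_left (mul_log_add_sub_le_mul_log_div ha₁ hb₁ h₁ hc) hs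
  have k₂ := mul_le_mul_of_nonneg_left (mul_log_add_sub_le_mul_log_div ha₂ hb₂ h₂ hc) ht0
  linarith

lemma IsRQD.convex_comb {M : ℕ} {p q : Fin M → Finset (Fin M) → ℝ} (hp : IsRQD M p)
    (hq : IsRQD M q) {t : ℝ} (ht0 : 0 ≤ t) (ht1 : t ≤ 1) :
    IsRQD M (fun m u => (1 - t) * p m u + t * q m u) := by
  refine ⟨fun m u => add_nonneg (mul_nonneg (by linarith) (hp.1 m u))
    (mul_nonneg ht0 (hq.1 m u)), fun m => ?_, fun m u h => ?_⟩
  · rw [Finset.sum_add_distrib, ← Finset.mul_sum, ← Finset.mul_sum, hp.2.1, hq.2.1]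
    ring
  · simp [hp.2.2 m u h, hq.2.2 m u h]

lemma dlCost_convex_comb {M : ℕ} (p q : Fin M → Finset (Fin M) → ℝ) (t : ℝ) :
    dlCost M (fun m u => (1 - t) * p m u + t * q m u) =
      (1 - t) * dlCost M p + t * dlCost M q := by
  simp only [dlCost, add_mul, Finset.sum_add_distrib, mul_assoc, ← Finset.mul_sum]
  ring

lemma IsRQD.marginal_nonneg {M : ℕ} {p : Fin M → Finset (Fin M) → ℝ} (hp : IsRQD M p)
    (u : Finset (Fin M)) : 0 ≤ (1 / (M : ℝ)) * ∑ m, p m u :=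
  mul_nonneg (by positivity) (Finset.sum_nonneg fun m _ => hp.1 m u)

lemma IsRQD.eq_zero_of_marginal_eq_zero {M : ℕ} {p : Fin M → Finset (Fin M) → ℝ}
    (hp : IsRQD M p) {u : Finset (Fin M)} (m : Fin M)
    (h : (1 / (M : ℝ)) * ∑ m, p m u = 0) : p m u = 0 := by
  have hM : (1 / (M : ℝ)) ≠ 0 := one_div_ne_zero (Nat.cast_ne_zero.2 m.pos.ne')
  exact (Finset.sum_eq_zero_iff_of_nonneg fun m _ => hp.1 m u).1
    ((mul_eq_zero.1 h).resolve_left hM) m (Finset.mem_univ m)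

lemma miLeak_convex_comb_le {M : ℕ} {p q : Fin M → Finset (Fin M) → ℝ} (hp : IsRQD M p)
    (hq : IsRQD M q) {t : ℝ} (ht0 : 0 ≤ t) (ht1 : t ≤ 1) :
    miLeak M (fun m u => (1 - t) * p m u + t * q m u) ≤
      (1 - t) * miLeak M p + t * miLeak M q := by
  unfold miLeak
  rw [Finset.mul_sum, Finset.mul_sum, ← Finset.sum_add_distrib]
  refine Finset.sum_le_sum fun u _ => ?_
  rw [Finset.mul_sum _ _ (1 - t), Finset.mul_sum _ _ t, ← Finset.sum_add_distrib]
  refine Finset.sum_le_sum fun m _ => ?_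
  have hmarg : (1 / (M : ℝ)) * ∑ m', ((1 - t) * p m' u + t * q m' u) =
      (1 - t) * ((1 / (M : ℝ)) * ∑ m', p m' u) + t * ((1 / (M : ℝ)) * ∑ m', q m' u) := by
    rw [Finset.sum_add_distrib, ← Finset.mul_sum, ← Finset.mul_sum]
    ring
  rw [hmarg]
  have h := mul_log_div_convex_comb_le (hp.1 m u) (hq.1 m u) (hp.marginal_nonneg u)
    (hq.marginal_nonneg u) (hp.eq_zero_of_marginal_eq_zero m)
    (hq.eq_zero_of_marginal_eq_zero m) ht0 ht1
  have hk : 0 ≤ (1 / (M : ℝ)) / Real.log 2 :=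
    div_nonneg (by positivity) (Real.log_nonneg one_le_two)
  convert mul_le_mul_of_nonneg_left h hk using 1 <;> simp only [Real.logb] <;> ring

lemma dlCost_nonneg {M : ℕ} {p : Fin M → Finset (Fin M) → ℝ} (hp : IsRQD M p) :
    0 ≤ dlCost M p :=
  mul_nonneg (by positivity) (Finset.sum_nonneg fun m _ => Finset.sum_nonneg fun u _ =>
    mul_nonneg (hp.1 m u) (Nat.cast_nonneg _))

lemma DMI_le_dlCost {M : ℕ} {p : Fin M → Finset (Fin M) → ℝ} {ρ : ℝ} (hp : IsRQD M p)
    (hρ : miLeak M p ≤ ρ) : DMI M ρ ≤ dlCost M p :=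
  csInf_le ⟨0, by rintro _ ⟨q, hq, -, rfl⟩; exact dlCost_nonneg hq⟩ ⟨p, hp, hρ, rfl⟩

/-- Downloading every file is a query distribution with no leakage. -/
lemma exists_isRQD_miLeak_eq_zero (M : ℕ) :
    ∃ p : Fin M → Finset (Fin M) → ℝ, IsRQD M p ∧ miLeak M p = 0 := by
  refine ⟨fun _ u => if u = Finset.univ then 1 else 0,
    ⟨fun m u => ?_, fun m => ?_, fun m u h => ?_⟩, ?_⟩
  · positivity
  · simp
  · exact if_neg fun hu : u = Finset.univ => h (hu ▸ Finset.mem_univ m)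
  · refine Finset.sum_eq_zero fun u _ => Finset.sum_eq_zero fun m _ => ?_
    have hM : (M : ℝ) ≠ 0 := Nat.cast_ne_zero.2 m.pos.ne'
    by_cases hu : u = Finset.univ <;> simp [hu, hM]

lemma exists_dlCost_lt_DMI_add {M : ℕ} {ρ ε : ℝ} (hρ : 0 ≤ ρ) (hε : 0 < ε) :
    ∃ p, IsRQD M p ∧ miLeak M p ≤ ρ ∧ dlCost M p < DMI M ρ + ε := by
  obtain ⟨p₀, hp₀, h₀⟩ := exists_isRQD_miLeak_eq_zero M
  obtain ⟨_, ⟨p, hp, hpρ, rfl⟩, hlt⟩ := exists_lt_of_csInf_lt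
    (s := {d : ℝ | ∃ p, IsRQD M p ∧ miLeak M p ≤ ρ ∧ dlCost M p = d})
    ⟨_, p₀, hp₀, h₀.trans_le hρ, rfl⟩ (lt_add_of_pos_right (DMI M ρ) hε)
  exact ⟨p, hp, hpρ, hlt⟩

/-- The MI download-leakage function is convex on `[0, log₂ M]`. -/
theorem stmt7 (M : ℕ) (hM : 2 ≤ M) (ρ₁ ρ₂ lam : ℝ)
    (hρ₁0 : 0 ≤ ρ₁) (hρ₁1 : ρ₁ ≤ Real.logb 2 (M : ℝ))
    (hρ₂0 : 0 ≤ ρ₂) (hρ₂1 : ρ₂ ≤ Real.logb 2 (M : ℝ))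
    (hl0 : 0 ≤ lam) (hl1 : lam ≤ 1) :
    DMI M ((1 - lam) * ρ₁ + lam * ρ₂)
      ≤ (1 - lam) * DMI M ρ₁ + lam * DMI M ρ₂ := by
  refine le_of_forall_pos_le_add fun ε hε => ?_
  obtain ⟨p, hp, hpρ, hpd⟩ := exists_dlCost_lt_DMI_add (M := M) hρ₁0 hε
  obtain ⟨q, hq, hqρ, hqd⟩ := exists_dlCost_lt_DMI_add (M := M) hρ₂0 hε
  have hs : 0 ≤ 1 - lam := by linarith
  have hleak := (miLeak_convex_comb_le hp hq hl0 hl1).trans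
    (add_le_add (mul_le_mul_of_nonneg_left hpρ hs) (mul_le_mul_of_nonneg_left hqρ hl0))
  have hle := DMI_le_dlCost (hp.convex_comb hq hl0 hl1) hleak
  rw [dlCost_convex_comb] at hle
  have h₁ := mul_le_mul_of_nonneg_left hpd.le hs
  have h₂ := mul_le_mul_of_nonneg_left hqd.le hl0
  linarith
end

section
/- Let ℳ and 𝒰 be finite nonempty sets, let P be a probability mass function on ℳ, let L : ℳ × 𝒰 → ℝ, let λ > 0, and let ν : ℳ → ℝ_{>0} satisfy Σ_{m∈ℳ} ν(m)·2^{−λL(m,u)} ≤ 1 for every u ∈ 𝒰. Then for every conditional probability distribution p(u|m) from ℳ to 𝒰, the mutual information satisfies I(M;U) ≥ H(P) + Σ_m P(m) log₂ ν(m) − λ·Σ_{m,u} P(m)p(u|m)L(m,u), where I(M;U) = Σ_{m,u} P(m)p(u|m) log₂( p(u|m) / Σ_{m'} P(m')p(u|m') ) and H(P) = −Σ_m P(m) log₂ P(m), with the convention 0·log₂(·) = 0. -/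
open Finset Real

/-- The tangent-line bound `1 - 1 / x ≤ log x` at `x = a * b / (q * (n * 2 ^ (-l)))`, in base 2. -/
theorem mul_logb_div_tangent_bound {a b q n l : ℝ} (ha : 0 ≤ a) (hb : 0 ≤ b)
    (hq : a * b ≤ q) (hn : 0 < n) :
    a * b * (-Real.logb 2 a + Real.logb 2 n - l)
        + (a * b - q * (n * (2 : ℝ) ^ (-l))) / Real.log 2
      ≤ a * b * Real.logb 2 (b / q) := by
  have hlog2 : 0 < Real.log 2 := Real.log_pos one_lt_two
  have hw : 0 < n * (2 : ℝ) ^ (-l) := by positivity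
  rcases (mul_nonneg ha hb).eq_or_lt with hab | hab
  · rw [← hab] at hq ⊢
    have : 0 ≤ q * (n * (2 : ℝ) ^ (-l)) / Real.log 2 := by positivity
    simpa [neg_div] using this
  · have ha' : 0 < a := pos_of_mul_pos_left hab hb
    have hb' : 0 < b := pos_of_mul_pos_right hab ha
    have hq' : 0 < q := hab.trans_le hq
    have hr : 0 < a * b / (q * (n * (2 : ℝ) ^ (-l))) := by positivity
    have key := mul_le_mul_of_nonneg_left (Real.one_sub_inv_le_log_of_pos hr) hab.le
    have hleft : a * b * (1 - (a * b / (q * (n * (2 : ℝ) ^ (-l))))⁻¹)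
        = a * b - q * (n * (2 : ℝ) ^ (-l)) := by
      field_simp
    rw [hleft, Real.log_div hab.ne' (by positivity), Real.log_mul ha'.ne' hb'.ne',
      Real.log_mul hq'.ne' hw.ne', Real.log_mul hn.ne' (by positivity),
      Real.log_rpow two_pos] at key
    simp only [Real.logb]
    rw [Real.log_div hb'.ne' hq'.ne', ← sub_nonneg]
    have hdiv := div_nonneg (sub_nonneg.2 key) hlog2.le
    refine hdiv.trans_eq ?_
    field_simp
    ring

/-- Gallager's lower bound on the rate-distortion function, adapted to the
leakage-download setting: if `Σ_m ν(m) 2^(−λ L(m,u)) ≤ 1` for every `u`, then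
`I(M;U) ≥ H(P) + Σ_m P(m) log₂ ν(m) − λ E[L(M,U)]`. -/
theorem stmt11 (ℳ 𝒰 : Type*) [Fintype ℳ] [Fintype 𝒰] [Nonempty ℳ] [Nonempty 𝒰]
    (P : ℳ → ℝ) (hP0 : ∀ m, 0 ≤ P m) (hP1 : ∑ m : ℳ, P m = 1)
    (L : ℳ → 𝒰 → ℝ) (lam : ℝ) (hlam : 0 < lam)
    (ν : ℳ → ℝ) (hν : ∀ m, 0 < ν m)
    (hcon : ∀ u : 𝒰, ∑ m : ℳ, ν m * (2 : ℝ) ^ (-(lam * L m u)) ≤ 1)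
    (p : ℳ → 𝒰 → ℝ) (hp0 : ∀ m u, 0 ≤ p m u) (hp1 : ∀ m, ∑ u : 𝒰, p m u = 1) :
    (-∑ m : ℳ, P m * Real.logb 2 (P m))
        + (∑ m : ℳ, P m * Real.logb 2 (ν m))
        - lam * ∑ m : ℳ, ∑ u : 𝒰, P m * p m u * L m u
      ≤ ∑ m : ℳ, ∑ u : 𝒰,
          P m * p m u * Real.logb 2 (p m u / ∑ m' : ℳ, P m' * p m' u) := by
  have hlog2 : 0 < Real.log 2 := Real.log_pos one_lt_two
  set q : 𝒰 → ℝ := fun u => ∑ m' : ℳ, P m' * p m' u with hq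
  have hq0 : ∀ u, 0 ≤ q u := fun u =>
    Finset.sum_nonneg fun m _ => mul_nonneg (hP0 m) (hp0 m u)
  have hjoint : ∑ m : ℳ, ∑ u : 𝒰, P m * p m u = 1 := by
    simp [← Finset.mul_sum, hp1, hP1]
  have hqsum : ∑ u : 𝒰, q u = 1 := by
    rw [hq, Finset.sum_comm, hjoint]
  have hmass : ∑ m : ℳ, ∑ u : 𝒰, q u * (ν m * (2 : ℝ) ^ (-(lam * L m u))) ≤ 1 := by
    rw [Finset.sum_comm, ← hqsum]
    refine Finset.sum_le_sum fun u _ => ?_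
    rw [← Finset.mul_sum]
    exact mul_le_of_le_one_right (hq0 u) (hcon u)
  have hterm := Finset.sum_le_sum fun (m : ℳ) (_ : m ∈ Finset.univ) =>
    Finset.sum_le_sum fun (u : 𝒰) (_ : u ∈ Finset.univ) =>
      mul_logb_div_tangent_bound (l := lam * L m u) (hP0 m) (hp0 m u)
        (Finset.single_le_sum (f := fun m' => P m' * p m' u)
          (fun m' _ => mul_nonneg (hP0 m') (hp0 m' u)) (Finset.mem_univ m)) (hν m)
  refine le_trans ?_ hterm
  have hmarg : ∀ f : ℳ → ℝ, ∑ m : ℳ, P m * f m = ∑ m : ℳ, ∑ u : 𝒰, P m * p m u * f m := by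
    intro f
    refine Finset.sum_congr rfl fun m _ => ?_
    rw [← Finset.sum_mul, ← Finset.mul_sum, hp1, mul_one]
  have hgap : 0 ≤ (∑ m : ℳ, ∑ u : 𝒰, P m * p m u
      - ∑ m : ℳ, ∑ u : 𝒰, q u * (ν m * (2 : ℝ) ^ (-(lam * L m u)))) / Real.log 2 :=
    div_nonneg (by linarith) hlog2.le
  rw [hmarg, hmarg]
  refine (le_add_of_nonneg_right hgap).trans_eq ?_
  simp only [← Finset.sum_sub_distrib, Finset.sum_div, ← Finset.sum_neg_distrib,
    ← Finset.sum_add_distrib, Finset.mul_sum]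
  refine Finset.sum_congr rfl fun m _ => Finset.sum_congr rfl fun u _ => ?_
  ring
end

section
/- Fix integers M ≥ 1 and 1 ≤ w ≤ M. Let Q_w = {u ∈ {0,1}^M : wt(u) = w} and define the conditional distribution P(u|m) = 1/C(M−1, w−1) if u ∈ Q_w and u_m = 1, and P(u|m) = 0 otherwise, where C(·,·) denotes the binomial coefficient. With the file index m uniform on {1,...,M}, the mutual information between the file index and the query equals log₂(M/w); that is, Σ_{u∈Q_w} Σ_{m : u_m=1} (1/M)·(1/C(M−1,w−1))·log₂( (1/C(M−1,w−1)) / ((1/M)Σ_{m'} P(u|m')) ) = log₂ M − log₂ w. -/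
open Finset Real

/-- The MI leakage of the capacity-achieving single-server WPIR scheme: to
retrieve file `m`, a uniformly random weight-`w` binary vector whose support
contains `m` is sent; the mutual information between the (uniform) file index and
the query is `log₂ M − log₂ w`. -/
theorem stmt12 (M w : ℕ) (hM : 1 ≤ M) (hw1 : 1 ≤ w) (hwM : w ≤ M)
    (P : Fin M → Finset (Fin M) → ℝ)
    (hP : ∀ m u, P m u =
      if u.card = w ∧ m ∈ u then (1 : ℝ) / ((M - 1).choose (w - 1)) else 0) :
    ∑ u ∈ Finset.univ.filter (fun u : Finset (Fin M) => u.card = w),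
      ∑ m ∈ u, (1 / (M : ℝ)) * ((1 : ℝ) / ((M - 1).choose (w - 1))) *
        Real.logb 2 (((1 : ℝ) / ((M - 1).choose (w - 1)))
          / ((1 / (M : ℝ)) * ∑ m' : Fin M, P m' u))
      = Real.logb 2 (M : ℝ) - Real.logb 2 (w : ℝ) := by
  obtain ⟨n, rfl⟩ := Nat.exists_eq_add_of_le' hM
  obtain ⟨k, rfl⟩ := Nat.exists_eq_add_of_le' hw1
  simp only [Nat.add_sub_cancel] at hP ⊢
  have hC : ((n.choose k : ℕ) : ℝ) ≠ 0 :=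
    Nat.cast_ne_zero.mpr (Nat.choose_pos (by omega)).ne'
  have hn : ((n + 1 : ℕ) : ℝ) ≠ 0 := by positivity
  have hk : ((k + 1 : ℕ) : ℝ) ≠ 0 := by positivity
  have hchoose : ((n + 1 : ℕ) : ℝ) * (n.choose k : ℕ) =
      ((n + 1).choose (k + 1) : ℕ) * ((k + 1 : ℕ) : ℝ) := by
    exact_mod_cast Nat.add_one_mul_choose_eq n k
  have hcard : (Finset.univ.filter
      (fun u : Finset (Fin (n + 1)) => u.card = k + 1)).card = (n + 1).choose (k + 1) := by
    rw [← Finset.powerset_univ, ← Finset.powersetCard_eq_filter, Finset.card_powersetCard,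
      Finset.card_univ, Fintype.card_fin]
  rw [← Real.logb_div hn hk]
  have hinner : ∀ u ∈ Finset.univ.filter (fun u : Finset (Fin (n + 1)) => u.card = k + 1),
      ∑ m ∈ u, (1 / ((n + 1 : ℕ) : ℝ)) * ((1 : ℝ) / (n.choose k)) *
        Real.logb 2 (((1 : ℝ) / (n.choose k))
          / ((1 / ((n + 1 : ℕ) : ℝ)) * ∑ m' : Fin (n + 1), P m' u)) =
      ((k + 1 : ℕ) : ℝ) * ((1 / ((n + 1 : ℕ) : ℝ)) * ((1 : ℝ) / (n.choose k)) *
        Real.logb 2 (((n + 1 : ℕ) : ℝ) / ((k + 1 : ℕ) : ℝ))) := by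
    intro u hu
    have hu : u.card = k + 1 := (Finset.mem_filter.mp hu).2
    have hsum : ∑ m' : Fin (n + 1), P m' u = ((k + 1 : ℕ) : ℝ) * (1 / (n.choose k)) := by
      simp only [hP, hu, true_and, Finset.sum_ite_mem, Finset.univ_inter, Finset.sum_const,
        nsmul_eq_mul]
    have hratio : ((1 : ℝ) / (n.choose k)) / ((1 / ((n + 1 : ℕ) : ℝ)) *
        (((k + 1 : ℕ) : ℝ) * (1 / (n.choose k)))) = ((n + 1 : ℕ) : ℝ) / ((k + 1 : ℕ) : ℝ) := by
      field_simp
    rw [hsum, hratio, Finset.sum_const, hu, nsmul_eq_mul]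
  rw [Finset.sum_congr rfl hinner, Finset.sum_const, hcard, nsmul_eq_mul]
  generalize Real.logb 2 _ = L
  field_simp
  linear_combination (-L) * hchoose
end

section
/- Fix integers M ≥ 1 and 1 ≤ w ≤ M. Let Q_w = {u ∈ {0,1}^M : wt(u) = w} and define the conditional distribution P(u|m) = 1/C(M−1, w−1) if u ∈ Q_w and u_m = 1, and P(u|m) = 0 otherwise, where C(·,·) denotes the binomial coefficient. Then Σ_{u ∈ Q_w} max_{m ∈ {1,...,M}} P(u|m) = C(M,w)/C(M−1,w−1) = M/w; consequently the maximal leakage of this scheme equals log₂(M/w). -/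
open Finset Real

/-- The MaxL quantity of the capacity-achieving single-server WPIR scheme:
`Σ_{u : wt(u)=w} max_m P(u|m) = C(M,w)/C(M−1,w−1) = M/w`, so the maximal leakage
equals `log₂(M/w)`. -/
theorem stmt13 (M w : ℕ) (hM : 1 ≤ M) (hw1 : 1 ≤ w) (hwM : w ≤ M)
    (P : Fin M → Finset (Fin M) → ℝ)
    (hP : ∀ m u, P m u =
      if u.card = w ∧ m ∈ u then (1 : ℝ) / ((M - 1).choose (w - 1)) else 0) :
    ((∑ u ∈ Finset.univ.filter (fun u : Finset (Fin M) => u.card = w),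
        ⨆ m : Fin M, P m u)
      = (M.choose w : ℝ) / (((M - 1).choose (w - 1) : ℕ) : ℝ)) ∧
    ((∑ u ∈ Finset.univ.filter (fun u : Finset (Fin M) => u.card = w),
        ⨆ m : Fin M, P m u)
      = (M : ℝ) / (w : ℝ)) ∧
    (Real.logb 2 (∑ u ∈ Finset.univ.filter (fun u : Finset (Fin M) => u.card = w),
        ⨆ m : Fin M, P m u)
      = Real.logb 2 ((M : ℝ) / (w : ℝ))) := by
  have hmax : ∀ u ∈ Finset.univ.filter (fun u : Finset (Fin M) => u.card = w),
      ⨆ m : Fin M, P m u = 1 / (((M - 1).choose (w - 1) : ℕ) : ℝ) := by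
    intro u hu
    have hcard : u.card = w := (Finset.mem_filter.mp hu).2
    obtain ⟨m, hm⟩ : u.Nonempty := Finset.card_pos.mp (by omega)
    have : Nonempty (Fin M) := ⟨m⟩
    apply le_antisymm
    · refine ciSup_le fun k => ?_
      rw [hP]
      split_ifs
      · exact le_rfl
      · positivity
    · refine le_ciSup_of_le (Set.finite_range _).bddAbove m ?_
      rw [hP, if_pos ⟨hcard, hm⟩]
  have hsum : (∑ u ∈ Finset.univ.filter (fun u : Finset (Fin M) => u.card = w),
      ⨆ m : Fin M, P m u) = (M.choose w : ℝ) / (((M - 1).choose (w - 1) : ℕ) : ℝ) := by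
    have hcount : (Finset.univ.filter (fun u : Finset (Fin M) => u.card = w)).card
        = M.choose w := by
      rw [Finset.univ_filter_card_eq, Finset.card_powersetCard, Finset.card_univ,
        Fintype.card_fin]
    rw [Finset.sum_congr rfl hmax, Finset.sum_const, hcount, nsmul_eq_mul, mul_one_div]
  have hratio : (M.choose w : ℝ) / (((M - 1).choose (w - 1) : ℕ) : ℝ) = (M : ℝ) / w := by
    have hchoose : (((M - 1).choose (w - 1) : ℕ) : ℝ) ≠ 0 :=
      Nat.cast_ne_zero.mpr (Nat.choose_pos (by omega)).ne'
    have hw : (w : ℝ) ≠ 0 := Nat.cast_ne_zero.mpr (by omega)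
    have habsorb : M * (M - 1).choose (w - 1) = M.choose w * w := by
      have := Nat.add_one_mul_choose_eq (M - 1) (w - 1)
      rwa [Nat.sub_add_cancel hM, Nat.sub_add_cancel hw1] at this
    rw [div_eq_div_iff hchoose hw]
    exact_mod_cast habsorb.symm
  exact ⟨hsum, hsum.trans hratio, by rw [hsum, hratio]⟩
end

section
/- Let w ≥ 2 be an integer and set λ = log₂(w/(w−1)). Then for every integer k ≥ 1, w·λ − log₂ w ≤ k·λ − log₂ k. Equivalently, setting ν = 2^{wλ}/w, one has k·ν·2^{−kλ} ≤ 1 for all integers k ≥ 1, so the pair (ν, λ) satisfies the constraint Σ_m ν·2^{−λL(m,u)} ≤ 1 of the rate-distortion lower bound for every nonzero binary vector u when L(m,u) = wt(u) for m in the support of u. -/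
open Real

/-- The sequence `k ↦ k * (1 - 1 / w) ^ k` attains its maximum at `k = w`. -/
theorem natCast_mul_one_sub_inv_pow_le {w : ℕ} (hw : 1 ≤ w) (k : ℕ) :
    (k : ℝ) * (1 - (w : ℝ)⁻¹) ^ k ≤ (w : ℝ) * (1 - (w : ℝ)⁻¹) ^ w := by
  have hw1 : (1 : ℝ) ≤ w := by exact_mod_cast hw
  have hw0 : (0 : ℝ) < w := by linarith
  have hinv : (w : ℝ)⁻¹ ≤ 1 := inv_le_one_of_one_le₀ hw1
  have hs : 0 ≤ 1 - (w : ℝ)⁻¹ := by linarith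
  rcases le_total w k with h | h
  · induction k, h using Nat.le_induction with
    | base => exact le_rfl
    | succ k hk ih =>
      refine le_trans ?_ ih
      have hkw : (w : ℝ) ≤ k := by exact_mod_cast hk
      have hstep : ((k : ℝ) + 1) * (1 - (w : ℝ)⁻¹) ≤ k := by
        have : 1 ≤ (k : ℝ) * (w : ℝ)⁻¹ := by
          rw [← div_eq_mul_inv]; exact (one_le_div hw0).2 hkw
        nlinarith [inv_pos.2 hw0]
      calc ((k + 1 : ℕ) : ℝ) * (1 - (w : ℝ)⁻¹) ^ (k + 1)
          = (((k : ℝ) + 1) * (1 - (w : ℝ)⁻¹)) * (1 - (w : ℝ)⁻¹) ^ k := by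
            push_cast; ring
        _ ≤ k * (1 - (w : ℝ)⁻¹) ^ k := by gcongr
  · obtain ⟨d, hd⟩ := Nat.exists_eq_add_of_le h
    have hdw : (w : ℝ) = k + d := by exact_mod_cast hd
    have hb := one_add_mul_le_pow (a := -(w : ℝ)⁻¹) (by linarith) d
    rw [← sub_eq_add_neg 1 (w : ℝ)⁻¹] at hb
    have hk : (k : ℝ) ≤ w * (1 - (w : ℝ)⁻¹) ^ d := by
      calc (k : ℝ) = w * (1 + d * -(w : ℝ)⁻¹) := by
            field_simp; linarith
        _ ≤ w * (1 - (w : ℝ)⁻¹) ^ d := by gcongr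
    calc (k : ℝ) * (1 - (w : ℝ)⁻¹) ^ k
        ≤ (w * (1 - (w : ℝ)⁻¹) ^ d) * (1 - (w : ℝ)⁻¹) ^ k := by gcongr
      _ = w * (1 - (w : ℝ)⁻¹) ^ (k + d) := by ring
      _ = w * (1 - (w : ℝ)⁻¹) ^ w := by rw [← hd]

/-- Verification of the Lagrange multipliers `(ν, λ) = (2^{wλ}/w, log₂(w/(w−1)))`
used in the converse for the MI metric: for all integers `k ≥ 1`,
`wλ − log₂ w ≤ kλ − log₂ k`, equivalently `k·ν·2^{−kλ} ≤ 1`. -/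
theorem stmt14 (w : ℕ) (hw : 2 ≤ w) (lam ν : ℝ)
    (hlam : lam = Real.logb 2 ((w : ℝ) / ((w : ℝ) - 1)))
    (hν : ν = (2 : ℝ) ^ ((w : ℝ) * lam) / (w : ℝ)) :
    ∀ k : ℕ, 1 ≤ k →
      ((w : ℝ) * lam - Real.logb 2 (w : ℝ)
          ≤ (k : ℝ) * lam - Real.logb 2 (k : ℝ)) ∧
      ((k : ℝ) * ν * (2 : ℝ) ^ (-((k : ℝ) * lam)) ≤ 1) := by
  intro k hk
  have hw2 : (2 : ℝ) ≤ w := by exact_mod_cast hw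
  have hw0 : (0 : ℝ) < w := by linarith
  have hk0 : (0 : ℝ) < k := by exact_mod_cast hk
  have hs : 0 < 1 - (w : ℝ)⁻¹ := sub_pos.2 (inv_lt_one_of_one_lt₀ (by linarith))
  have hlog : Real.logb 2 (1 - (w : ℝ)⁻¹) = -lam := by
    rw [hlam, ← Real.logb_inv]
    congr 1
    field_simp
  have key : (w : ℝ) * lam - Real.logb 2 w ≤ k * lam - Real.logb 2 k := by
    have h := Real.logb_le_logb_of_le one_lt_two (by positivity)
      (natCast_mul_one_sub_inv_pow_le (by omega : 1 ≤ w) k)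
    rw [Real.logb_mul hk0.ne' (by positivity), Real.logb_mul hw0.ne' (by positivity),
      Real.logb_pow, Real.logb_pow, hlog] at h
    linarith
  refine ⟨key, ?_⟩
  have hkpow := Real.rpow_logb two_pos (by norm_num) hk0
  have hwpow := Real.rpow_logb two_pos (by norm_num) hw0
  calc (k : ℝ) * ν * (2 : ℝ) ^ (-((k : ℝ) * lam))
      = (2 : ℝ) ^ (Real.logb 2 k + (w * lam - Real.logb 2 w) + -(k * lam)) := by
        rw [Real.rpow_add two_pos, Real.rpow_add two_pos, Real.rpow_sub two_pos,
          hkpow, hwpow, hν]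
    _ ≤ 1 := Real.rpow_le_one_of_one_le_of_nonpos one_le_two (by linarith)
end

section
/- Fix an integer M ≥ 2. For every reduced query distribution p and every integer w with 2 ≤ w ≤ M, the MI leakage is bounded below by ρ^MI(p) ≥ log₂(M/(w−1)) − log₂(w/(w−1))·(D(p) − (w−1)). In particular, the minimum MI leakage achievable with download cost at most D, for w−1 ≤ D ≤ w, is at least log₂(M/(w−1)) − log₂(w/(w−1))·(D − (w−1)). -/
open Finset Real

theorem log_succ_sub_log_anti {a b : ℝ} (ha : 0 < a) (hab : a ≤ b) :
    Real.log (b + 1) - Real.log b ≤ Real.log (a + 1) - Real.log a := by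
  have hb : 0 < b := ha.trans_le hab
  rw [← Real.log_div (by positivity) hb.ne', ← Real.log_div (by positivity) ha.ne']
  apply Real.log_le_log (by positivity)
  rw [div_le_div_iff₀ hb ha]
  linarith

/-- The chord of `log` through `v` and `v + 1` lies above `log` at every positive integer. -/
theorem log_nat_le_chord (v k : ℕ) (hv : 1 ≤ v) (hk : 1 ≤ k) :
    Real.log k ≤ Real.log v + (Real.log (v + 1) - Real.log v) * ((k : ℝ) - v) := by
  rcases le_total v k with h | h
  · induction k, h using Nat.le_induction with
    | base => simp
    | succ n hn ih =>
      have h1 := ih (hv.trans hn)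
      have h2 := log_succ_sub_log_anti (a := (v : ℝ)) (b := n) (by positivity) (by exact_mod_cast hn)
      push_cast
      linarith
  · obtain ⟨d, rfl⟩ := Nat.exists_eq_add_of_le h
    clear h
    induction d generalizing k with
    | zero => simp
    | succ d ih =>
      have h1 := ih (k + 1) (by omega) (by omega)
      have h2 := log_succ_sub_log_anti (a := (k : ℝ)) (b := ((k + (d + 1) : ℕ) : ℝ))
        (by positivity) (by push_cast; linarith [(d.cast_nonneg : (0 : ℝ) ≤ d)])
      rw [show k + 1 + d = k + (d + 1) by omega] at h1
      push_cast at h1 h2 ⊢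
      linarith

/-- A termwise form of the log-sum inequality. -/
theorem mul_log_div_ge {a S c k : ℝ} (ha : 0 ≤ a) (haS : a ≤ S) (hc : 0 < c) (hk : 0 < k) :
    a * (Real.log c - Real.log k) + (a - S / k) ≤ a * Real.log (a / ((1 / c) * S)) := by
  rcases ha.eq_or_lt with rfl | ha
  · have : 0 ≤ S / k := by positivity
    simpa using this
  · have hS : 0 < S := ha.trans_le haS
    have h := Real.one_sub_inv_le_log_of_pos (x := a * k / S) (by positivity)
    rw [Real.log_div (by positivity) hS.ne', Real.log_mul ha.ne' hk.ne'] at h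
    rw [Real.log_div ha.ne' (by positivity), Real.log_mul (by positivity) hS.ne',
      one_div, Real.log_inv]
    have h2 := mul_le_mul_of_nonneg_left h ha.le
    have h3 : a * (1 - (a * k / S)⁻¹) = a - S / k := by field_simp
    linarith

/-- The log-sum inequality for a nonnegative family supported on `u`. -/
theorem sum_mul_log_div_ge {ι : Type*} [Fintype ι] (a : ι → ℝ) (u : Finset ι)
    (ha : ∀ i, 0 ≤ a i) (hu : ∀ i, i ∉ u → a i = 0) {c : ℝ} (hc : 0 < c) :
    (∑ i, a i) * (Real.log c - Real.log u.card)
      ≤ ∑ i, a i * Real.log (a i / ((1 / c) * ∑ j, a j)) := by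
  have hsum : ∑ i ∈ u, a i = ∑ i, a i :=
    Finset.sum_subset (Finset.subset_univ u) fun i _ hi => hu i hi
  have hlog : ∑ i ∈ u, a i * Real.log (a i / ((1 / c) * ∑ j, a j))
      = ∑ i, a i * Real.log (a i / ((1 / c) * ∑ j, a j)) :=
    Finset.sum_subset (Finset.subset_univ u) fun i _ hi => by rw [hu i hi, zero_mul]
  rw [← hlog]
  rcases u.eq_empty_or_nonempty with rfl | hne
  · simp [show ∀ i, a i = 0 from fun i => hu i (by simp)]
  · have hk : (0 : ℝ) < u.card := by exact_mod_cast hne.card_pos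
    have h := Finset.sum_le_sum fun i (_ : i ∈ u) => mul_log_div_ge (ha i)
      (Finset.single_le_sum (fun j _ => ha j) (Finset.mem_univ i)) hc hk
    rw [Finset.sum_add_distrib, Finset.sum_sub_distrib, ← Finset.sum_mul, hsum,
      Finset.sum_const, nsmul_eq_mul, mul_div_cancel₀ _ hk.ne'] at h
    linarith

/-- The piecewise-linear converse bound for the MI metric: for every reduced query
distribution `p` and every `2 ≤ w ≤ M`,
`ρ^MI(p) ≥ log₂(M/(w−1)) − log₂(w/(w−1))·(D(p) − (w−1))`. -/
theorem stmt15 (M : ℕ) (hM : 2 ≤ M) (p : Fin M → Finset (Fin M) → ℝ)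
    (hp : IsRQD M p) (w : ℕ) (hw2 : 2 ≤ w) (hwM : w ≤ M) :
    Real.logb 2 ((M : ℝ) / ((w : ℝ) - 1))
        - Real.logb 2 ((w : ℝ) / ((w : ℝ) - 1)) * (dlCost M p - ((w : ℝ) - 1))
      ≤ miLeak M p := by
  obtain ⟨hp0, hp1, hps⟩ := hp
  obtain ⟨v, rfl⟩ : ∃ v, w = v + 1 := ⟨w - 1, by omega⟩
  have hv : 1 ≤ v := by omega
  have hv0 : (0 : ℝ) < v := by exact_mod_cast hv
  have hM0 : (0 : ℝ) < M := by exact_mod_cast (by omega : 0 < M)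
  have hlog2 : 0 < Real.log 2 := Real.log_pos one_lt_two
  have hvc : ((v + 1 : ℕ) : ℝ) - 1 = v := by push_cast; ring
  rw [hvc, Nat.cast_succ]
  set L : ℝ := Real.log (v + 1) - Real.log v with hL
  have hterm : ∀ u : Finset (Fin M),
      (∑ m, p m u) * (Real.log M - Real.log v - L * (u.card - v))
        ≤ ∑ m, p m u * Real.log (p m u / ((1 / M) * ∑ m', p m' u)) := by
    intro u
    refine le_trans ?_ (sum_mul_log_div_ge (fun m => p m u) u (hp0 · u) (hps · u) hM0)
    rcases u.eq_empty_or_nonempty with rfl | hne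
    · simp [hps]
    · have := log_nat_le_chord v u.card hv hne.card_pos
      exact mul_le_mul_of_nonneg_left (by linarith) (Finset.sum_nonneg fun m _ => hp0 m u)
  have htotal := Finset.sum_le_sum fun u (_ : u ∈ Finset.univ) => hterm u
  have hmass : ∑ u : Finset (Fin M), ∑ m, p m u = M := by
    rw [Finset.sum_comm]; simp [hp1]
  have hcost : ∑ u : Finset (Fin M), (∑ m, p m u) * u.card = M * dlCost M p := by
    simp only [dlCost, Finset.sum_mul]
    rw [Finset.sum_comm]
    field_simp
  have hleft : ∑ u : Finset (Fin M), (∑ m, p m u) * (Real.log M - Real.log v - L * (u.card - v))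
      = M * (Real.log M - Real.log v - L * (dlCost M p - v)) := by
    calc _ = (∑ u : Finset (Fin M), ∑ m, p m u) * (Real.log M - Real.log v + L * v)
          - L * ∑ u : Finset (Fin M), (∑ m, p m u) * u.card := by
          rw [Finset.sum_mul, Finset.mul_sum, ← Finset.sum_sub_distrib]
          exact Finset.sum_congr rfl fun u _ => by ring
      _ = _ := by rw [hmass, hcost]; ring
  have hright : ∑ u : Finset (Fin M), ∑ m, p m u * Real.log (p m u / ((1 / M) * ∑ m', p m' u))
      = M * (miLeak M p * Real.log 2) := by
    simp only [miLeak, Finset.sum_mul, Finset.mul_sum (a := (M : ℝ)), Real.logb]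
    refine Finset.sum_congr rfl fun u _ => Finset.sum_congr rfl fun m _ => ?_
    field_simp
  rw [hleft, hright] at htotal
  have hmain := le_of_mul_le_mul_left htotal hM0
  rw [Real.logb, Real.logb, Real.log_div hM0.ne' hv0.ne', Real.log_div (by positivity) hv0.ne',
    ← hL, div_mul_eq_mul_div, ← sub_div, div_le_iff₀ hlog2]
  exact hmain
end

section
/- Fix an integer M ≥ 2 and an integer w with 2 ≤ w ≤ M. For every reduced query distribution p whose download cost satisfies w−1 ≤ D(p) ≤ w, the MaxL quantity is bounded below by Λ(p) ≥ M·(w − D(p))/(w−1) + M·(D(p) − (w−1))/w. Equivalently, the minimum maximal leakage achievable with download cost at most D ∈ [w−1, w] is at least log₂( M(w−D)/(w−1) + M(D−w+1)/w ). -/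
open Finset Real

/-- Tangent-type bound: the mass of `u` weighted by the chord of `k ↦ 1 / k` through `w - 1` and `w`
is at most the maximum over the files. -/
theorem IsRQD.sum_mul_le_iSup {M : ℕ} {p : Fin M → Finset (Fin M) → ℝ} (hp : IsRQD M p)
    {w : ℕ} (hw : 1 ≤ w) (u : Finset (Fin M)) :
    (∑ m, p m u) * (2 * (w : ℝ) - 1 - u.card) ≤ (w : ℝ) * (w - 1) * ⨆ m, p m u := by
  obtain ⟨hnonneg, -, hzero⟩ := hp
  have hsup : 0 ≤ ⨆ m, p m u := Real.iSup_nonneg fun m => hnonneg m u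
  have hsum : 0 ≤ ∑ m, p m u := Finset.sum_nonneg fun m _ => hnonneg m u
  have hle : ∑ m, p m u ≤ u.card * ⨆ m, p m u := by
    rw [← Finset.sum_subset (Finset.subset_univ u) fun m _ hm => hzero m u hm, ← nsmul_eq_mul]
    exact Finset.sum_le_card_nsmul _ _ _ fun m _ =>
      le_ciSup (f := fun m => p m u) (Set.finite_range _).bddAbove m
  have hw' : (1 : ℝ) ≤ w := by exact_mod_cast hw
  have hint : 0 ≤ ((u.card : ℝ) - w) * (u.card - w + 1) := by
    rcases lt_or_ge u.card w with h | h
    · have : (u.card : ℝ) + 1 ≤ w := by exact_mod_cast h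
      nlinarith
    · have : (w : ℝ) ≤ u.card := by exact_mod_cast h
      nlinarith
  rcases le_total (2 * (w : ℝ) - 1 - u.card) 0 with hc | hc
  · exact (mul_nonpos_of_nonneg_of_nonpos hsum hc).trans
      (mul_nonneg (mul_nonneg (by linarith) (by linarith)) hsup)
  · calc (∑ m, p m u) * (2 * (w : ℝ) - 1 - u.card)
        ≤ (u.card * ⨆ m, p m u) * (2 * (w : ℝ) - 1 - u.card) :=
          mul_le_mul_of_nonneg_right hle hc
      _ = (u.card * (2 * (w : ℝ) - 1 - u.card)) * ⨆ m, p m u := by ring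
      _ ≤ _ := mul_le_mul_of_nonneg_right (by nlinarith) hsup

/-- Converse bound for the MaxL metric: every reduced query distribution with
download cost in `[w−1, w]` satisfies
`Λ(p) ≥ M(w − D(p))/(w−1) + M(D(p) − (w−1))/w`. -/
theorem stmt17 (M w : ℕ) (hM : 2 ≤ M) (hw2 : 2 ≤ w) (hwM : w ≤ M)
    (p : Fin M → Finset (Fin M) → ℝ) (hp : IsRQD M p)
    (hD1 : (w : ℝ) - 1 ≤ dlCost M p) (hD2 : dlCost M p ≤ (w : ℝ)) :
    (M : ℝ) * ((w : ℝ) - dlCost M p) / ((w : ℝ) - 1)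
        + (M : ℝ) * (dlCost M p - ((w : ℝ) - 1)) / (w : ℝ)
      ≤ maxlQ M p := by
  have hM0 : (M : ℝ) ≠ 0 := by positivity
  have hw : (2 : ℝ) ≤ w := by exact_mod_cast hw2
  have hmass : ∑ u : Finset (Fin M), ∑ m, p m u = M := by
    rw [Finset.sum_comm]
    simp [hp.2.1]
  have hcost : ∑ u : Finset (Fin M), (∑ m, p m u) * u.card = M * dlCost M p := by
    simp only [Finset.sum_mul, dlCost]
    rw [Finset.sum_comm]
    field_simp
  have hkey : (M : ℝ) * (2 * w - 1 - dlCost M p) ≤ w * (w - 1) * maxlQ M p := by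
    calc (M : ℝ) * (2 * w - 1 - dlCost M p)
        = ∑ u : Finset (Fin M), (∑ m, p m u) * (2 * (w : ℝ) - 1 - u.card) := by
          simp only [mul_sub (∑ m, p m _), Finset.sum_sub_distrib, ← Finset.sum_mul, hmass, hcost]
          ring
      _ ≤ _ := by
          rw [maxlQ, Finset.mul_sum]
          exact Finset.sum_le_sum fun u _ => hp.sum_mul_le_iSup (by omega) u
  have hpos : (0 : ℝ) < w - 1 := by linarith
  rw [div_add_div _ _ hpos.ne' (by positivity), div_le_iff₀ (by positivity)]
  linarith
end

section
/- Fix an integer M ≥ 2, an integer w with 2 ≤ w ≤ M, and a real D with w−1 ≤ D ≤ w. Consider the linear program: minimize M − Σ_{v=2}^{M} (1 − 1/v)·y_v over real variables y_2,...,y_M ≥ 0 subject to Σ_{v=2}^{M} y_v ≤ M and Σ_{v=2}^{M} (v−1)·y_v ≤ M(D−1). Its optimal value equals M(w−D)/(w−1) + M(D−(w−1))/w, attained at y_{w−1} = M(w−D), y_w = M(D−(w−1)), and y_v = 0 for all other v (for w = 2, at y_2 = M(D−1) and all other y_v = 0). -/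
open Finset Real

/-- A weighted sum over `[2, M]` of a sequence supported on `{w - 1, w}`, for weights such that the
index `w - 1` either lies in `[2, M]` or has weight zero. -/
lemma sum_Icc_two_mul_ite_pred {M w : ℕ} (hw2 : 2 ≤ w) (hwM : w ≤ M) (g : ℕ → ℝ) (a b : ℝ)
    (hg : w = 2 → g (w - 1) = 0) :
    ∑ v ∈ Finset.Icc 2 M, g v * (if v = w - 1 then a else if v = w then b else 0)
      = g (w - 1) * a + g w * b := by
  have hsplit : ∀ v, g v * (if v = w - 1 then a else if v = w then b else 0)
      = (if v = w - 1 then g v * a else 0) + (if v = w then g v * b else 0) := by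
    intro v
    by_cases h1 : v = w - 1
    · have h2 : v ≠ w := by omega
      simp [h1, show w - 1 ≠ w by omega]
    · simp [h1]
  simp only [hsplit, Finset.sum_add_distrib, Finset.sum_ite_eq', Finset.mem_Icc]
  rw [if_pos (And.intro hw2 hwM)]
  split_ifs with h
  · rfl
  · rw [hg (by omega), zero_mul]

/-- The line through the points of the concave function `v ↦ 1 - 1 / v` at `w - 1` and `w` lies
above it at every positive integer `v`. -/
lemma one_sub_one_div_le_secant {v w : ℕ} (hv : 0 < v) (hw : 2 ≤ w) :
    1 - 1 / (v : ℝ) ≤ (1 - 2 / (w : ℝ)) + 1 / ((w : ℝ) * (w - 1)) * ((v : ℝ) - 1) := by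
  have hv' : (0 : ℝ) < v := by exact_mod_cast hv
  have hw' : (2 : ℝ) ≤ w := by exact_mod_cast hw
  have hw0 : (0 : ℝ) < w := by linarith
  have hw1 : (0 : ℝ) < w - 1 := by linarith
  have hprod : (0 : ℝ) ≤ ((v : ℝ) - w) * ((v : ℝ) - w + 1) := by
    rcases lt_or_ge v w with h | h
    · have : (v : ℝ) + 1 ≤ w := by exact_mod_cast h
      nlinarith
    · have : (w : ℝ) ≤ v := by exact_mod_cast h
      nlinarith
  have hdiff : (1 - 2 / (w : ℝ)) + 1 / ((w : ℝ) * (w - 1)) * ((v : ℝ) - 1) - (1 - 1 / (v : ℝ))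
      = ((v : ℝ) - w) * ((v : ℝ) - w + 1) / (v * (w * (w - 1))) := by
    field_simp
    ring
  rw [← sub_nonneg, hdiff]
  positivity

/-- The linear-programming relaxation of the minimum-MaxL problem: minimize
`M − Σ_{v=2}^M (1 − 1/v) y_v` subject to `y_v ≥ 0`, `Σ y_v ≤ M`, and
`Σ (v−1) y_v ≤ M(D−1)`. Its optimal value is
`M(w−D)/(w−1) + M(D−(w−1))/w`, attained at `y_{w−1} = M(w−D)`,
`y_w = M(D−(w−1))`, and `y_v = 0` otherwise. -/
theorem stmt18 (M w : ℕ) (hM : 2 ≤ M) (hw2 : 2 ≤ w) (hwM : w ≤ M)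
    (D : ℝ) (hD1 : (w : ℝ) - 1 ≤ D) (hD2 : D ≤ (w : ℝ)) :
    IsLeast {c : ℝ | ∃ y : ℕ → ℝ,
        (∀ v ∈ Finset.Icc 2 M, 0 ≤ y v) ∧
        (∑ v ∈ Finset.Icc 2 M, y v ≤ (M : ℝ)) ∧
        (∑ v ∈ Finset.Icc 2 M, ((v : ℝ) - 1) * y v ≤ (M : ℝ) * (D - 1)) ∧
        c = (M : ℝ) - ∑ v ∈ Finset.Icc 2 M, (1 - 1 / (v : ℝ)) * y v}
      ((M : ℝ) * ((w : ℝ) - D) / ((w : ℝ) - 1)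
        + (M : ℝ) * (D - ((w : ℝ) - 1)) / (w : ℝ)) ∧
    ((M : ℝ) - ∑ v ∈ Finset.Icc 2 M, (1 - 1 / (v : ℝ)) *
        (if v = w - 1 then (M : ℝ) * ((w : ℝ) - D)
         else if v = w then (M : ℝ) * (D - ((w : ℝ) - 1)) else 0))
      = (M : ℝ) * ((w : ℝ) - D) / ((w : ℝ) - 1)
        + (M : ℝ) * (D - ((w : ℝ) - 1)) / (w : ℝ) := by
  have hw' : (2 : ℝ) ≤ w := by exact_mod_cast hw2
  have hw0 : (0 : ℝ) < w := by linarith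
  have hw1 : (0 : ℝ) < w - 1 := by linarith
  have hM0 : (0 : ℝ) ≤ M := Nat.cast_nonneg M
  have hcast : ((w - 1 : ℕ) : ℝ) = w - 1 := by
    rw [Nat.cast_sub (by omega), Nat.cast_one]
  have ha : 0 ≤ (M : ℝ) * ((w : ℝ) - D) := mul_nonneg hM0 (by linarith)
  have hb : 0 ≤ (M : ℝ) * (D - ((w : ℝ) - 1)) := mul_nonneg hM0 (by linarith)
  have hval : ((M : ℝ) - ∑ v ∈ Finset.Icc 2 M, (1 - 1 / (v : ℝ)) *
        (if v = w - 1 then (M : ℝ) * ((w : ℝ) - D)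
         else if v = w then (M : ℝ) * (D - ((w : ℝ) - 1)) else 0))
      = (M : ℝ) * ((w : ℝ) - D) / ((w : ℝ) - 1)
        + (M : ℝ) * (D - ((w : ℝ) - 1)) / (w : ℝ) := by
    rw [sum_Icc_two_mul_ite_pred hw2 hwM (fun v => 1 - 1 / (v : ℝ)) _ _
      (by rintro rfl; norm_num), hcast]
    field_simp
    ring
  refine ⟨⟨⟨fun v => if v = w - 1 then (M : ℝ) * ((w : ℝ) - D)
      else if v = w then (M : ℝ) * (D - ((w : ℝ) - 1)) else 0, ?_, ?_, ?_, hval.symm⟩, ?_⟩, hval⟩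
  · intro v _
    dsimp only
    split_ifs <;> first | assumption | exact le_rfl
  · rcases hw2.eq_or_lt with rfl | hw3
    · have h := sum_Icc_two_mul_ite_pred le_rfl hwM (fun v => if v = 1 then (0 : ℝ) else 1)
        ((M : ℝ) * (((2 : ℕ) : ℝ) - D)) ((M : ℝ) * (D - (((2 : ℕ) : ℝ) - 1))) (by simp)
      rw [Finset.sum_congr rfl (g := fun v => if v = 2 - 1 then (M : ℝ) * (((2 : ℕ) : ℝ) - D)
        else if v = 2 then (M : ℝ) * (D - (((2 : ℕ) : ℝ) - 1)) else 0)] at h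
      · rw [h]
        norm_num at hD2 ha ⊢
        nlinarith
      · intro v hv
        have : v ≠ 1 := by have := (Finset.mem_Icc.mp hv).1; omega
        simp [this]
    · have h := sum_Icc_two_mul_ite_pred hw2 hwM (fun _ => (1 : ℝ))
        ((M : ℝ) * ((w : ℝ) - D)) ((M : ℝ) * (D - ((w : ℝ) - 1))) (by omega)
      simp only [one_mul] at h
      rw [h]
      linarith
  · rw [sum_Icc_two_mul_ite_pred hw2 hwM (fun v => (v : ℝ) - 1) _ _
      (by rintro rfl; norm_num), hcast]
    linarith
  · rintro c ⟨y, hy, hsum, hcost, rfl⟩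
    have hα : 0 ≤ 1 - 2 / (w : ℝ) := sub_nonneg.mpr ((div_le_one hw0).mpr hw')
    have hβ : 0 ≤ 1 / ((w : ℝ) * (w - 1)) := by positivity
    have hbound : ∑ v ∈ Finset.Icc 2 M, (1 - 1 / (v : ℝ)) * y v
        ≤ (1 - 2 / (w : ℝ)) * M + 1 / ((w : ℝ) * (w - 1)) * (M * (D - 1)) :=
      calc ∑ v ∈ Finset.Icc 2 M, (1 - 1 / (v : ℝ)) * y v
          ≤ ∑ v ∈ Finset.Icc 2 M, ((1 - 2 / (w : ℝ)) * y v
              + 1 / ((w : ℝ) * (w - 1)) * (((v : ℝ) - 1) * y v)) := by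
            refine Finset.sum_le_sum fun v hv => ?_
            have hv0 : 0 < v := by have := (Finset.mem_Icc.mp hv).1; omega
            have := mul_le_mul_of_nonneg_right (one_sub_one_div_le_secant hv0 hw2) (hy v hv)
            linarith
        _ = (1 - 2 / (w : ℝ)) * ∑ v ∈ Finset.Icc 2 M, y v
              + 1 / ((w : ℝ) * (w - 1)) * ∑ v ∈ Finset.Icc 2 M, ((v : ℝ) - 1) * y v := by
            rw [Finset.sum_add_distrib, ← Finset.mul_sum, ← Finset.mul_sum]
        _ ≤ _ := add_le_add (mul_le_mul_of_nonneg_left hsum hα)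
            (mul_le_mul_of_nonneg_left hcost hβ)
    have hopt : (M : ℝ) * ((w : ℝ) - D) / ((w : ℝ) - 1)
          + (M : ℝ) * (D - ((w : ℝ) - 1)) / (w : ℝ)
        = M - ((1 - 2 / (w : ℝ)) * M + 1 / ((w : ℝ) * (w - 1)) * (M * (D - 1))) := by
      field_simp
      ring
    rw [hopt]
    linarith
end

section
/- Consider the linear program: minimize c·x over x ∈ ℝⁿ subject to A x = b and x ≥ 0, where A is a real m×n matrix, b ∈ ℝᵐ, and c ∈ ℝⁿ. Let B ⊆ {1,...,n} be a set of m column indices such that the m×m submatrix A_B of A is invertible, and let x be the basic feasible solution with x_N = 0 on the complement N of B and x_B = A_B^{−1} b ≥ 0. If the relative cost vector for the nonbasic variables, c_N − c_B A_B^{−1} A_N, is componentwise nonnegative (where A_N is the submatrix of A with columns in N and c_B, c_N are the corresponding subvectors of c), then x is optimal: c·x ≤ c·x′ for every x′ ∈ ℝⁿ with A x′ = b and x′ ≥ 0. -/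
open Finset Matrix

/-- Complementary slackness: if `y` is dual feasible for `min c·x, Ax = b, x ≥ 0` and the slack
`c - yA` is orthogonal to the solution `x` of `Ax = b`, then `x` is optimal. -/
theorem dotProduct_le_of_complementary_slackness {ι κ R : Type*} [Fintype ι] [Fintype κ]
    [CommRing R] [PartialOrder R] [IsOrderedRing R] {A : Matrix ι κ R} {b : ι → R} {c : κ → R}
    {x x' : κ → R} (y : ι → R)
    (hx : A *ᵥ x = b) (hx' : A *ᵥ x' = b) (hx'_nonneg : 0 ≤ x')
    (hslack : 0 ≤ c - y ᵥ* A) (hcompl : (c - y ᵥ* A) ⬝ᵥ x = 0) :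
    c ⬝ᵥ x ≤ c ⬝ᵥ x' := by
  have h := dotProduct_nonneg_of_nonneg hslack hx'_nonneg
  rw [sub_dotProduct, ← dotProduct_mulVec, hx', sub_nonneg] at h
  rw [sub_dotProduct, ← dotProduct_mulVec, hx, sub_eq_zero] at hcompl
  exact hcompl.trans_le h

/-- Sufficient optimality condition for a basic feasible solution of a linear
program in standard form (minimize `c·x` subject to `Ax = b`, `x ≥ 0`): if the
relative cost vector `c_N − c_B A_B⁻¹ A_N` for the nonbasic variables is
nonnegative, then the basic feasible solution is optimal. The basis is encoded by
an injection `β : Fin m → Fin n` selecting the basic columns. -/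
theorem stmt19 (m n : ℕ) (A : Matrix (Fin m) (Fin n) ℝ)
    (b : Fin m → ℝ) (c : Fin n → ℝ)
    (β : Fin m → Fin n) (hβ : Function.Injective β)
    (hInv : IsUnit (A.submatrix (id : Fin m → Fin m) β).det)
    (x : Fin n → ℝ)
    (hxN : ∀ j, j ∉ Set.range β → x j = 0)
    (hxb : A.mulVec x = b)
    (hx0 : ∀ j, 0 ≤ x j)
    (hred : ∀ j, j ∉ Set.range β →
      0 ≤ c j - ∑ i : Fin m,
        Matrix.vecMul (fun i => c (β i)) (A.submatrix (id : Fin m → Fin m) β)⁻¹ i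
          * A i j) :
    ∀ x' : Fin n → ℝ, A.mulVec x' = b → (∀ j, 0 ≤ x' j) →
      ∑ j : Fin n, c j * x j ≤ ∑ j : Fin n, c j * x' j := by
  intro x' hx'b hx'0
  set AB := A.submatrix (id : Fin m → Fin m) β
  set y := Matrix.vecMul (fun i => c (β i)) AB⁻¹ with hy
  have hbasic : ∀ i, (c - y ᵥ* A) (β i) = 0 := by
    intro i
    have h : y ᵥ* AB = fun i => c (β i) := by
      rw [hy, vecMul_vecMul, nonsing_inv_mul _ hInv, vecMul_one]
    exact sub_eq_zero.mpr (congrFun h i).symm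
  refine dotProduct_le_of_complementary_slackness y hxb hx'b hx'0 (fun j => ?_)
    (Finset.sum_eq_zero fun j _ => ?_)
  · by_cases hj : j ∈ Set.range β
    · obtain ⟨i, rfl⟩ := hj
      exact (hbasic i).ge
    · exact hred j hj
  · by_cases hj : j ∈ Set.range β
    · obtain ⟨i, rfl⟩ := hj
      rw [hbasic, zero_mul]
    · rw [hxN j hj, mul_zero]
end
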